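/- arXiv:1111.5559 — 2 statements merged into one kernel-verified Lean document; each statement's English description precedes it below -/
import Mathlib

section
/- Let 𝔤 be a finite-dimensional real Lie algebra and let S be a subset of the dual space 𝔤* whose linear span is all of 𝔤*. Suppose there is a linear subspace W of 𝔤 such that for every λ ∈ S one has W = {Z ∈ 𝔤 : λ(⁅Z, X⁆) = 0 for all X ∈ 𝔤}. Then W equals the center of 𝔤. -/
/-- If the stabilizer subalgebra `{Z : λ ⁅Z, X⁆ = 0 ∀ X}` is a constant subspace `W`
as `λ` ranges over a spanning set `S` of functionals, then `W` is the center. -/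
theorem stmt0 (g : Type*) [LieRing g] [LieAlgebra ℝ g] [FiniteDimensional ℝ g]
    (S : Set (Module.Dual ℝ g)) (hS : Submodule.span ℝ S = ⊤)
    (W : Submodule ℝ g)
    (hW : ∀ l ∈ S, ∀ Z : g, Z ∈ W ↔ ∀ X : g, l ⁅Z, X⁆ = 0) :
    ∀ Z : g, Z ∈ W ↔ ∀ X : g, ⁅Z, X⁆ = 0 := by
  have eq_zero_of_forall : ∀ Y : g, (∀ l ∈ S, l Y = 0) → Y = 0 := fun Y hY ↦ by
    refine (Module.forall_dual_apply_eq_zero_iff ℝ Y).1 fun l ↦ ?_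
    have hle : Submodule.span ℝ S ≤ LinearMap.ker (Module.Dual.eval ℝ g Y) :=
      Submodule.span_le.2 fun l hl ↦ hY l hl
    exact hle (hS ▸ Submodule.mem_top : l ∈ Submodule.span ℝ S)
  refine fun Z ↦ ⟨fun hZ X ↦ eq_zero_of_forall _ fun l hl ↦ (hW l hl Z).1 hZ X, fun hZ ↦ ?_⟩
  obtain rfl | ⟨l, hl⟩ := S.eq_empty_or_nonempty
  · rw [eq_zero_of_forall Z (by simp)]
    exact W.zero_mem
  · exact (hW l hl Z).2 fun X ↦ by rw [hZ X, map_zero]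
end

section
/- Let d ≥ 1 and let C be an invertible 2d×2d real matrix with Λ = Cℤ^{2d}. There exists g ∈ L²(ℝ^d) such that the Gabor system G(g, Λ) = {π(z)g : z ∈ Λ} is an orthonormal basis of L²(ℝ^d) if and only if |det C| = 1. -/
open MeasureTheory

/-- The time-frequency shift `(π(t,ω)g)(x) = e^{2πi⟨ω, x⟩} g(x − t)`. -/
noncomputable def tfShift {d : ℕ} (t ω : Fin d → ℝ)
    (g : Lp ℂ 2 (volume : Measure (Fin d → ℝ))) : (Fin d → ℝ) → ℂ :=
  fun x => Complex.exp (2 * Real.pi * Complex.I * ((∑ i, ω i * x i : ℝ) : ℂ)) * g (x - t)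

section Intertwiners

open ContinuousLinearMap InnerProductSpace
open scoped InnerProductSpace

variable {I L H E : Type*}
  [NormedAddCommGroup L] [InnerProductSpace ℂ L]
  [NormedAddCommGroup H] [InnerProductSpace ℂ H]
  [NormedAddCommGroup E] [InnerProductSpace ℂ E]

/-- The bounded operators intertwining two families of unitaries. -/
def intertwiners (l : I → L ≃ₗᵢ[ℂ] L) (r : I → H ≃ₗᵢ[ℂ] H) : Submodule ℂ (L →L[ℂ] H) where
  carrier := {T | ∀ k x, T (l k x) = r k (T x)}
  add_mem' := fun hS hT k x => by simp [hS k x, hT k x]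
  zero_mem' := fun k x => by simp
  smul_mem' := fun c T hT k x => by simp [hT k x]

variable {l : I → L ≃ₗᵢ[ℂ] L} {r : I → H ≃ₗᵢ[ℂ] H} {e : I → E ≃ₗᵢ[ℂ] E}

theorem mem_intertwiners {T : L →L[ℂ] H} :
    T ∈ intertwiners l r ↔ ∀ k x, T (l k x) = r k (T x) := Iff.rfl

theorem intertwiners_comp {S : H →L[ℂ] E} {T : L →L[ℂ] H} (hS : S ∈ intertwiners r e)
    (hT : T ∈ intertwiners l r) : S ∘L T ∈ intertwiners l e := fun k x => by
  simp [hT k x, hS k (T x)]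

theorem intertwiners_id : ContinuousLinearMap.id ℂ L ∈ intertwiners l l := fun _ _ => rfl

theorem intertwiners_adjoint [CompleteSpace L] [CompleteSpace H] {T : L →L[ℂ] H} (hT : T ∈ intertwiners l r) :
    adjoint T ∈ intertwiners r l := fun k y => by
  refine ext_inner_right ℂ fun x => ?_
  have h : r k (T ((l k).symm x)) = T x := by rw [← hT k]; simp
  rw [adjoint_inner_left, ← h, LinearIsometryEquiv.inner_map_map, ← adjoint_inner_left,
    ← LinearIsometryEquiv.inner_map_map (l k), LinearIsometryEquiv.apply_symm_apply]

/-- The forms `(x, y) ↦ ⟪y, T x⟫` of contractive intertwiners `T`. -/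
def contractionForms (l : I → L ≃ₗᵢ[ℂ] L) (r : I → H ≃ₗᵢ[ℂ] H) : Set (L × H → ℂ) :=
  {b | ∃ T ∈ intertwiners l r, ‖T‖ ≤ 1 ∧ b = fun p => ⟪p.2, T p.1⟫_ℂ}

variable [CompleteSpace H]

theorem mem_contractionForms_iff {b : L × H → ℂ} :
    b ∈ contractionForms l r ↔
      (∀ x x' y, b (x + x', y) = b (x, y) + b (x', y)) ∧
      (∀ (c : ℂ) x y, b (c • x, y) = c * b (x, y)) ∧
      (∀ x y y', b (x, y + y') = b (x, y) + b (x, y')) ∧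
      (∀ (c : ℂ) x y, b (x, c • y) = (starRingEnd ℂ c) * b (x, y)) ∧
      (∀ x y, ‖b (x, y)‖ ≤ ‖x‖ * ‖y‖) ∧
      (∀ k x y, b (l k x, r k y) = b (x, y)) := by
  constructor
  · rintro ⟨T, hT, hT1, rfl⟩
    refine ⟨?_, ?_, ?_, ?_, ?_, ?_⟩
    · intros; simp
    · intros; simp
    · intros; simp
    · intros; simp [mul_comm]
    · intro x y
      calc ‖⟪y, T x⟫_ℂ‖ ≤ ‖y‖ * ‖T x‖ := norm_inner_le_norm _ _
        _ ≤ ‖y‖ * (1 * ‖x‖) := by gcongr; exact T.le_of_opNorm_le hT1 x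
        _ = ‖x‖ * ‖y‖ := by ring
    · intro k x y
      simp [hT k x]
  · rintro ⟨h1, h2, h3, h4, h5, h6⟩
    let φ : L → (H →L[ℂ] ℂ) := fun x => LinearMap.mkContinuous
      { toFun := fun y => (starRingEnd ℂ) (b (x, y))
        map_add' := fun y y' => by simp [h3]
        map_smul' := fun c y => by simp [h4] } ‖x‖ fun y => by simpa using h5 x y
    have hφ : ∀ x y, φ x y = (starRingEnd ℂ) (b (x, y)) := fun _ _ => rfl
    have hi : ∀ x y, ⟪y, (toDual ℂ H).symm (φ x)⟫_ℂ = b (x, y) := fun x y => by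
      rw [← inner_conj_symm, toDual_symm_apply, hφ, Complex.conj_conj]
    let T : L →L[ℂ] H := LinearMap.mkContinuous
      { toFun := fun x => (toDual ℂ H).symm (φ x)
        map_add' := fun x x' => by
          refine ext_inner_left ℂ fun y => ?_
          simp only [inner_add_right, hi, h1]
        map_smul' := fun c x => by
          refine ext_inner_left ℂ fun y => ?_
          simp only [inner_smul_right, hi, h2, RingHom.id_apply] } 1 fun x => by
        simp only [LinearMap.coe_mk, AddHom.coe_mk, LinearIsometryEquiv.norm_map, one_mul]
        exact LinearMap.mkContinuous_norm_le _ (norm_nonneg _) _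
    have hTi : ∀ x y, ⟪y, T x⟫_ℂ = b (x, y) := hi
    refine ⟨T, fun k x => ?_, LinearMap.mkContinuous_norm_le _ zero_le_one _, ?_⟩
    · refine ext_inner_left ℂ fun y => ?_
      obtain ⟨y, rfl⟩ := (r k).surjective y
      rw [hTi, h6, LinearIsometryEquiv.inner_map_map, hTi]
    · ext p
      rw [hTi]

theorem isCompact_contractionForms : IsCompact (contractionForms l r) := by
  have hc : IsCompact (Set.univ.pi fun p : L × H => Metric.closedBall (0 : ℂ) (‖p.1‖ * ‖p.2‖)) :=
    isCompact_univ_pi fun p => isCompact_closedBall _ _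
  refine hc.of_isClosed_subset ?_ ?_
  · have : contractionForms l r = {b : L × H → ℂ |
        (∀ x x' y, b (x + x', y) = b (x, y) + b (x', y)) ∧
        (∀ (c : ℂ) x y, b (c • x, y) = c * b (x, y)) ∧
        (∀ x y y', b (x, y + y') = b (x, y) + b (x, y')) ∧
        (∀ (c : ℂ) x y, b (x, c • y) = (starRingEnd ℂ c) * b (x, y)) ∧
        (∀ x y, ‖b (x, y)‖ ≤ ‖x‖ * ‖y‖) ∧
        (∀ k x y, b (l k x, r k y) = b (x, y))} := Set.ext fun b => mem_contractionForms_iff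
    rw [this]
    simp only [Set.ofPred_and, Set.ofPred_forall]
    refine IsClosed.inter ?_ <| IsClosed.inter ?_ <| IsClosed.inter ?_ <| IsClosed.inter ?_ <|
      IsClosed.inter ?_ ?_
    · exact isClosed_iInter fun _ => isClosed_iInter fun _ => isClosed_iInter fun _ =>
        isClosed_eq (by fun_prop) (by fun_prop)
    · exact isClosed_iInter fun _ => isClosed_iInter fun _ => isClosed_iInter fun _ =>
        isClosed_eq (by fun_prop) (by fun_prop)
    · exact isClosed_iInter fun _ => isClosed_iInter fun _ => isClosed_iInter fun _ =>
        isClosed_eq (by fun_prop) (by fun_prop)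
    · exact isClosed_iInter fun _ => isClosed_iInter fun _ => isClosed_iInter fun _ =>
        isClosed_eq (by fun_prop) (by fun_prop)
    · exact isClosed_iInter fun _ => isClosed_iInter fun _ =>
        isClosed_le (by fun_prop) (by fun_prop)
    · exact isClosed_iInter fun _ => isClosed_iInter fun _ => isClosed_iInter fun _ =>
        isClosed_eq (by fun_prop) (by fun_prop)
  · intro b hb p _
    simpa using (mem_contractionForms_iff.1 hb).2.2.2.2.1 p.1 p.2

/-- There is a contractive intertwiner that is extreme among contractive intertwiners. -/
theorem exists_extreme_intertwiner (l : I → L ≃ₗᵢ[ℂ] L) (r : I → H ≃ₗᵢ[ℂ] H) :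
    ∃ T ∈ intertwiners l r, ‖T‖ ≤ 1 ∧ ∀ S ∈ intertwiners l r,
      ‖T + S‖ ≤ 1 → ‖T - S‖ ≤ 1 → S = 0 := by
  obtain ⟨b, hb⟩ := (isCompact_contractionForms (l := l) (r := r)).extremePoints_nonempty
    ⟨_, 0, zero_mem _, by simp, rfl⟩
  obtain ⟨⟨T, hT, hT1, rfl⟩, hext⟩ := mem_extremePoints.1 hb
  refine ⟨T, hT, hT1, fun S hS hp hm => ?_⟩
  have := hext _ ⟨T + S, add_mem hT hS, hp, rfl⟩ _ ⟨T - S, sub_mem hT hS, hm, rfl⟩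
    ⟨1 / 2, 1 / 2, by norm_num, by norm_num, by norm_num, by
      ext p
      simp
      ring⟩
  ext x
  refine ext_inner_left ℂ fun y => ?_
  have h := congrFun this.1 (x, y)
  simpa [inner_add_right] using h

end Intertwiners

section Extreme

open ContinuousLinearMap InnerProductSpace
open scoped InnerProductSpace

variable {I L H : Type*}
  [NormedAddCommGroup L] [InnerProductSpace ℂ L]
  [NormedAddCommGroup H] [InnerProductSpace ℂ H]
  {l : I → L ≃ₗᵢ[ℂ] L} {r : I → H ≃ₗᵢ[ℂ] H} {T : L →L[ℂ] H}

theorem apply_le_of_norm_le_one (hT1 : ‖T‖ ≤ 1) (x : L) : ‖T x‖ ≤ ‖x‖ := by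
  simpa using T.le_of_opNorm_le hT1 x

theorem norm_le_one_of_sq_le {S : L →L[ℂ] H} (h : ∀ x, ‖S x‖ ^ 2 ≤ ‖x‖ ^ 2) : ‖S‖ ≤ 1 :=
  S.opNorm_le_bound zero_le_one fun x => by
    rw [one_mul]
    exact le_of_sq_le_sq (h x) (norm_nonneg _)

variable [CompleteSpace L] [CompleteSpace H]

theorem adjoint_apply_le_of_norm_le_one (hT1 : ‖T‖ ≤ 1) (x : H) : ‖adjoint T x‖ ≤ ‖x‖ :=
  apply_le_of_norm_le_one (T := adjoint T) (by simpa using hT1) x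

/-- An extreme contractive intertwiner is a partial isometry. -/
theorem apply_adjoint_apply_of_extreme (hT : T ∈ intertwiners l r) (hT1 : ‖T‖ ≤ 1)
    (hext : ∀ S ∈ intertwiners l r, ‖T + S‖ ≤ 1 → ‖T - S‖ ≤ 1 → S = 0) (x : L) :
    T (adjoint T (T x)) = T x := by
  set S : L →L[ℂ] H := (2⁻¹ : ℂ) • (T - T ∘L (adjoint T ∘L T)) with hS
  have hSm : S ∈ intertwiners l r := Submodule.smul_mem _ _ <| sub_mem hT <|
    intertwiners_comp hT <| intertwiners_comp (intertwiners_adjoint hT) hT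
  have h0 : S = 0 := by
    refine hext S hSm ?_ ?_
    · refine norm_le_one_of_sq_le fun x => ?_
      set D := adjoint T (T x) with hD
      have e1 : (T + S) x = (2⁻¹ : ℂ) • ((3 : ℂ) • T x - T D) := by
        simp only [hS, hD, add_apply, smul_apply, sub_apply, comp_apply]
        module
      have e2 : ‖T x - T D‖ ^ 2 ≤ ‖x - D‖ ^ 2 := by
        rw [← map_sub]
        gcongr
        exact apply_le_of_norm_le_one hT1 _
      have e3 : ‖x - D‖ ^ 2 = ‖x‖ ^ 2 - 2 * ‖T x‖ ^ 2 + (⟪T x, T D⟫_ℂ).re := by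
        rw [norm_sub_sq (𝕜 := ℂ)]
        have a1 : ⟪x, D⟫_ℂ = ⟪T x, T x⟫_ℂ := adjoint_inner_right _ _ _
        have a2 : ⟪D, D⟫_ℂ = ⟪T x, T D⟫_ℂ := adjoint_inner_left _ _ _
        rw [a1, ← a2, inner_self_eq_norm_sq_to_K, inner_self_eq_norm_sq_to_K]
        norm_cast
      have e4 : ‖T x - T D‖ ^ 2 = ‖T x‖ ^ 2 - 2 * (⟪T x, T D⟫_ℂ).re + ‖T D‖ ^ 2 :=
        norm_sub_sq (𝕜 := ℂ) _ _
      have e5 : ‖(3 : ℂ) • T x - T D‖ ^ 2 =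
          9 * ‖T x‖ ^ 2 - 6 * (⟪T x, T D⟫_ℂ).re + ‖T D‖ ^ 2 := by
        rw [norm_sub_sq (𝕜 := ℂ), inner_smul_left, norm_smul]
        simp
        ring
      have e6 : 0 ≤ ‖x - D‖ ^ 2 := by positivity
      rw [e1, norm_smul, mul_pow, e5]
      norm_num
      linarith
    · refine norm_le_one_of_sq_le fun x => ?_
      have e1 : (T - S) x = (2⁻¹ : ℂ) • (T x + T (adjoint T (T x))) := by
        simp only [hS, sub_apply, smul_apply, comp_apply]
        module
      have e2 : ‖T x + T (adjoint T (T x))‖ ≤ ‖x‖ + ‖x‖ := by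
        refine (norm_add_le _ _).trans ?_
        have := apply_le_of_norm_le_one hT1 x
        have := apply_le_of_norm_le_one hT1 (adjoint T (T x))
        have := adjoint_apply_le_of_norm_le_one hT1 (T x)
        linarith
      rw [e1, norm_smul]
      gcongr
      norm_num
      linarith
  have := congrArg (fun A : L →L[ℂ] H => A x) h0
  simp only [hS, smul_apply, sub_apply, comp_apply, zero_apply, smul_eq_zero, inv_eq_zero,
    OfNat.ofNat_ne_zero, false_or] at this
  exact (sub_eq_zero.1 this).symm

/-- The defect spaces of an extreme contractive intertwiner are disjoint. -/
theorem disjoint_defect_of_extreme (hT : T ∈ intertwiners l r) (hT1 : ‖T‖ ≤ 1)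
    (hext : ∀ S ∈ intertwiners l r, ‖T + S‖ ≤ 1 → ‖T - S‖ ≤ 1 → S = 0)
    {S : L →L[ℂ] H} (hS : S ∈ intertwiners l r) (x : L) :
    S (x - adjoint T (T x)) = T (adjoint T (S (x - adjoint T (T x)))) := by
  have hp := apply_adjoint_apply_of_extreme hT hT1 hext
  set R : H →L[ℂ] H := ContinuousLinearMap.id ℂ H - T ∘L adjoint T with hR
  set F : L →L[ℂ] L := ContinuousLinearMap.id ℂ L - adjoint T ∘L T with hF
  have hTR : adjoint T ∘L R = 0 := by
    ext y
    refine ext_inner_right ℂ fun z => ?_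
    have : ⟪T (adjoint T y), T z⟫_ℂ = ⟪y, T z⟫_ℂ := by
      rw [← adjoint_inner_right T, adjoint_inner_left, hp]
    simp [hR, adjoint_inner_left, inner_sub_left, this]
  have hRm : R ∈ intertwiners r r :=
    sub_mem intertwiners_id (intertwiners_comp hT (intertwiners_adjoint hT))
  have hFm : F ∈ intertwiners l l :=
    sub_mem intertwiners_id (intertwiners_comp (intertwiners_adjoint hT) hT)
  set c : ℝ := (‖R ∘L S‖ + 1)⁻¹ with hc
  have hcpos : 0 < c := by positivity
  set S' : L →L[ℂ] H := (c : ℂ) • (R ∘L S ∘L F) with hS'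
  have hS'm : S' ∈ intertwiners l r := Submodule.smul_mem _ _ <|
    intertwiners_comp hRm <| intertwiners_comp hS hFm
  have hnS' : ∀ x, ‖S' x‖ ≤ ‖F x‖ := fun x => by
    simp only [hS', smul_apply, norm_smul, comp_apply, Complex.norm_real, Real.norm_eq_abs,
      abs_of_pos hcpos]
    have := (R ∘L S).le_opNorm (F x)
    rw [hc, inv_mul_le_iff₀ (by positivity)]
    simp only [comp_apply] at this
    nlinarith [norm_nonneg (F x)]
  have hor : ∀ x, ⟪T x, S' x⟫_ℂ = 0 := fun x => by
    rw [← adjoint_inner_right]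
    have := congrArg (fun A : H →L[ℂ] L => A (S (F x))) hTR
    simp only [comp_apply, zero_apply] at this
    simp [hS', this]
  have hsum : ∀ x, ‖T x‖ ^ 2 + ‖F x‖ ^ 2 = ‖x‖ ^ 2 := fun x => by
    have a1 : ⟪x, adjoint T (T x)⟫_ℂ = ⟪T x, T x⟫_ℂ := adjoint_inner_right _ _ _
    have a2 : ⟪adjoint T (T x), adjoint T (T x)⟫_ℂ = ⟪T x, T x⟫_ℂ := by
      rw [adjoint_inner_left, hp]
    have a3 : ‖adjoint T (T x)‖ ^ 2 = ‖T x‖ ^ 2 := by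
      rw [inner_self_eq_norm_sq_to_K, inner_self_eq_norm_sq_to_K] at a2
      exact_mod_cast a2
    have : ‖F x‖ ^ 2 = ‖x - adjoint T (T x)‖ ^ 2 := by simp [hF]
    rw [this, norm_sub_sq (𝕜 := ℂ), a1, a3, inner_self_eq_norm_sq_to_K]
    norm_cast
    ring
  have h0 : S' = 0 := by
    refine hext S' hS'm ?_ ?_
    · refine norm_le_one_of_sq_le fun x => ?_
      rw [add_apply, norm_add_sq (𝕜 := ℂ), hor, ← hsum x]
      have := pow_le_pow_left₀ (norm_nonneg _) (hnS' x) 2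
      simpa using this
    · refine norm_le_one_of_sq_le fun x => ?_
      rw [sub_apply, norm_sub_sq (𝕜 := ℂ), hor, ← hsum x]
      have := pow_le_pow_left₀ (norm_nonneg _) (hnS' x) 2
      simpa using this
  have := congrArg (fun A : L →L[ℂ] H => A x) h0
  simp only [hS', smul_apply, comp_apply, zero_apply, smul_eq_zero, Complex.ofReal_eq_zero,
    hcpos.ne', false_or] at this
  simpa [hR, hF, sub_eq_zero] using this

end Extreme

section CentralSupport

open ContinuousLinearMap InnerProductSpace
open scoped InnerProductSpace

variable {I L H : Type*}
  [NormedAddCommGroup L] [InnerProductSpace ℂ L] [CompleteSpace L]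
  [NormedAddCommGroup H] [InnerProductSpace ℂ H] [CompleteSpace H]

theorem starProjection_orthogonal_comm {A : L →L[ℂ] H} {K : Submodule ℂ L} {K' : Submodule ℂ H}
    (hA : ∀ x ∈ K, A x ∈ K') (hA' : ∀ y ∈ K', adjoint A y ∈ K) (x : L) :
    K'ᗮ.starProjection (A x) = A (Kᗮ.starProjection x) := by
  refine Submodule.eq_starProjection_of_mem_orthogonal' (z := A (x - Kᗮ.starProjection x))
    ?_ ?_ (by simp)
  · rw [Submodule.mem_orthogonal]
    intro y hy
    rw [← adjoint_inner_left]
    exact Submodule.inner_right_of_mem_orthogonal (hA' y hy) (Submodule.starProjection_apply_mem _ _)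
  · have hx : x - Kᗮ.starProjection x ∈ K.topologicalClosure := by
      rw [← Submodule.orthogonal_orthogonal_eq_closure]
      exact Submodule.sub_starProjection_mem_orthogonal _
    have : A (x - Kᗮ.starProjection x) ∈ K'.topologicalClosure :=
      map_mem_closure A.continuous hx hA
    rwa [← Submodule.orthogonal_orthogonal_eq_closure] at this

theorem starProjection_orthogonal_idem (K : Submodule ℂ L) (x : L) :
    Kᗮ.starProjection (Kᗮ.starProjection x) = Kᗮ.starProjection x :=
  Submodule.starProjection_eq_self_iff.2 (Submodule.starProjection_apply_mem _ _)

variable (l : I → L ≃ₗᵢ[ℂ] L) (r : I → H ≃ₗᵢ[ℂ] H) (T : L →L[ℂ] H)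

/-- The vectors sent by every intertwiner into the kernel of `1 - T T†`. -/
def defectKernel : Submodule ℂ L where
  carrier := {x | ∀ S ∈ intertwiners l r, T (adjoint T (S x)) = S x}
  add_mem' := fun hx hy S hS => by simp [hx S hS, hy S hS]
  zero_mem' := fun S hS => by simp
  smul_mem' := fun c x hx S hS => by simp [hx S hS]

/-- The vectors sent by the adjoint of every intertwiner into `defectKernel`. -/
def defectKernel' : Submodule ℂ H where
  carrier := {y | ∀ S ∈ intertwiners l r, adjoint S y ∈ defectKernel l r T}
  add_mem' := fun hx hy S hS => by
    rw [map_add]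
    exact add_mem (hx S hS) (hy S hS)
  zero_mem' := fun S hS => by simp
  smul_mem' := fun c x hx S hS => by
    rw [map_smul]
    exact Submodule.smul_mem _ _ (hx S hS)

variable {l r T}

theorem isClosed_defectKernel : IsClosed (defectKernel l r T : Set L) := by
  have : (defectKernel l r T : Set L) =
      ⋂ S ∈ intertwiners l r, {x | T (adjoint T (S x)) = S x} := by
    ext x
    simp [defectKernel]
  rw [this]
  exact isClosed_biInter fun S _ => isClosed_eq (by fun_prop) (by fun_prop)

theorem isClosed_defectKernel' : IsClosed (defectKernel' l r T : Set H) := by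
  have : (defectKernel' l r T : Set H) =
      ⋂ S ∈ intertwiners l r, adjoint S ⁻¹' (defectKernel l r T : Set L) := by
    ext x
    simp [defectKernel']
  rw [this]
  exact isClosed_biInter fun S _ => isClosed_defectKernel.preimage (by fun_prop)

theorem apply_mem_defectKernel' {S : L →L[ℂ] H} (hS : S ∈ intertwiners l r) {x : L}
    (hx : x ∈ defectKernel l r T) : S x ∈ defectKernel' l r T := by
  intro S₁ hS₁ S₂ hS₂
  have := hx (S₂ ∘L (adjoint S₁ ∘L S))
    (intertwiners_comp hS₂ (intertwiners_comp (intertwiners_adjoint hS₁) hS))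
  simpa only [comp_apply] using this

theorem starProjection_defectKernel_apply {S : L →L[ℂ] H} (hS : S ∈ intertwiners l r) (x : L) :
    (defectKernel' l r T)ᗮ.starProjection (S x) = S ((defectKernel l r T)ᗮ.starProjection x) :=
  starProjection_orthogonal_comm (fun _ hx => apply_mem_defectKernel' hS hx)
    (fun _ hy => hy S hS) x

/-- An extreme contractive intertwiner is isometric off its defect kernel. -/
theorem adjoint_apply_starProjection_defectKernel (hT : T ∈ intertwiners l r) (hT1 : ‖T‖ ≤ 1)
    (hext : ∀ S ∈ intertwiners l r, ‖T + S‖ ≤ 1 → ‖T - S‖ ≤ 1 → S = 0) (x : L) :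
    adjoint T (T ((defectKernel l r T)ᗮ.starProjection x)) =
      (defectKernel l r T)ᗮ.starProjection x := by
  set q := (defectKernel l r T)ᗮ.starProjection x
  have hq : q ∈ (defectKernel l r T)ᗮ := Submodule.starProjection_apply_mem _ _
  refine ext_inner_left ℂ fun z => ?_
  have hz : z - adjoint T (T z) ∈ defectKernel l r T := fun S hS =>
    (disjoint_defect_of_extreme hT hT1 hext hS z).symm
  have := Submodule.inner_right_of_mem_orthogonal hz hq
  rw [inner_sub_left, sub_eq_zero] at this
  rw [this, adjoint_inner_right, adjoint_inner_left]

theorem apply_adjoint_apply_of_mem_defectKernel' (hT : T ∈ intertwiners l r)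
    (hnd : ∀ y : H, (∀ S ∈ intertwiners l r, adjoint S y = 0) → y = 0) {y : H}
    (hy : y ∈ defectKernel' l r T) : T (adjoint T y) = y := by
  set R : H →L[ℂ] H := ContinuousLinearMap.id ℂ H - T ∘L adjoint T with hR
  have hRm : R ∈ intertwiners r r :=
    sub_mem intertwiners_id (intertwiners_comp hT (intertwiners_adjoint hT))
  have hRd : ∀ z, R z = z - T (adjoint T z) := fun _ => rfl
  have hRs : ∀ u v, ⟪R u, v⟫_ℂ = ⟪u, R v⟫_ℂ := fun u v => by
    simp only [hR, sub_apply, comp_apply, id_apply, inner_sub_left, inner_sub_right]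
    rw [← adjoint_inner_right T, ← adjoint_inner_left T]
  have h0 : R y = 0 := by
    refine hnd _ fun S hS => ?_
    have hRS : R ∘L S ∈ intertwiners l r := intertwiners_comp hRm hS
    have h1 := hy _ hRS S hS
    have h2 : adjoint (R ∘L S) y = adjoint S (R y) := by
      refine ext_inner_right ℂ fun v => ?_
      rw [adjoint_inner_left, adjoint_inner_left, hRs, comp_apply]
    rw [h2] at h1
    have h3 : R (S (adjoint S (R y))) = 0 := by rw [hRd, h1, sub_self]
    have h4 : ⟪adjoint S (R y), adjoint S (R y)⟫_ℂ = 0 := by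
      rw [adjoint_inner_left, hRs, h3, inner_zero_right]
    exact inner_self_eq_zero.1 h4
  rw [hRd] at h0
  exact (sub_eq_zero.1 h0).symm

theorem apply_adjoint_sub_starProjection (hT : T ∈ intertwiners l r)
    (hnd : ∀ y : H, (∀ S ∈ intertwiners l r, adjoint S y = 0) → y = 0) (y : H) :
    T (adjoint T (y - (defectKernel' l r T)ᗮ.starProjection y)) =
      y - (defectKernel' l r T)ᗮ.starProjection y := by
  refine apply_adjoint_apply_of_mem_defectKernel' hT hnd ?_
  have : y - (defectKernel' l r T)ᗮ.starProjection y ∈ (defectKernel' l r T)ᗮᗮ :=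
    Submodule.sub_starProjection_mem_orthogonal _
  rwa [Submodule.orthogonal_orthogonal_eq_closure,
    isClosed_defectKernel'.submodule_topologicalClosure_eq] at this

/-- The central support is invariant under twisting the two families simultaneously. -/
theorem starProjection_defectKernel_twist (hT : T ∈ intertwiners l r) {V : L ≃ₗᵢ[ℂ] L} {k : I}
    (h1 : ∀ S ∈ intertwiners l r,
      (r k).toContinuousLinearEquiv.toContinuousLinearMap ∘L S ∘L
        V.symm.toContinuousLinearEquiv.toContinuousLinearMap ∈ intertwiners l r)
    (h2 : ∀ S ∈ intertwiners l r,
      (r k).symm.toContinuousLinearEquiv.toContinuousLinearMap ∘L S ∘L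
        V.toContinuousLinearEquiv.toContinuousLinearMap ∈ intertwiners l r) (x : L) :
    (defectKernel l r T)ᗮ.starProjection (V x) = V ((defectKernel l r T)ᗮ.starProjection x) := by
  have hTT := intertwiners_comp hT (intertwiners_adjoint hT)
  refine starProjection_orthogonal_comm
    (A := V.toContinuousLinearEquiv.toContinuousLinearMap) ?_ ?_ x
  · intro x hx S hS
    have := hx _ (h2 S hS)
    have h3 := congrArg (r k) this
    rw [← comp_apply T, ← mem_intertwiners.1 hTT] at h3
    simpa using h3
  · intro x hx S hS
    have := hx _ (h1 S hS)
    have hV : adjoint V.toContinuousLinearEquiv.toContinuousLinearMap x = V.symm x := by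
      refine ext_inner_right ℂ fun v => ?_
      rw [adjoint_inner_left, ← V.inner_map_map (V.symm x)]
      simp
    rw [hV]
    refine (r k).injective ?_
    have h3 : T (adjoint T (r k (S (V.symm x)))) = r k (T (adjoint T (S (V.symm x)))) :=
      mem_intertwiners.1 hTT k _
    rw [← h3]
    simpa using this

end CentralSupport

section HilbertBases

open ContinuousLinearMap InnerProductSpace
open scoped InnerProductSpace ENNReal

variable {I L H : Type*}
  [NormedAddCommGroup L] [InnerProductSpace ℂ L]
  [NormedAddCommGroup H] [InnerProductSpace ℂ H]

theorem HilbertBasis.tsum_enorm_inner_sq (b : HilbertBasis I ℂ L) (x : L) :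
    ∑' i, ‖⟪b i, x⟫_ℂ‖ₑ ^ 2 = ‖x‖ₑ ^ 2 := by
  have h := b.hasSum_inner_mul_inner x x
  have h' : HasSum (fun i => ‖⟪b i, x⟫_ℂ‖ ^ 2) (‖x‖ ^ 2) := by
    rw [← Complex.hasSum_ofReal]
    convert! h using 1
    · ext i
      rw [← inner_conj_symm x (b i), Complex.conj_mul']
      norm_cast
    · rw [inner_self_eq_norm_sq_to_K]
      norm_cast
  have e : ∀ z : ℝ, 0 ≤ z → ENNReal.ofReal (z ^ 2) = ENNReal.ofReal z ^ 2 := fun z hz =>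
    ENNReal.ofReal_pow hz 2
  simp_rw [← ofReal_norm, ← e _ (norm_nonneg _)]
  rw [← h'.tsum_eq, ENNReal.ofReal_tsum_of_nonneg (fun _ => by positivity) h'.summable]

theorem HilbertBasis.ext_continuousLinearMap (b : HilbertBasis I ℂ L) {S T : L →L[ℂ] H}
    (h : ∀ i, S (b i) = T (b i)) : S = T :=
  ContinuousLinearMap.ext_on (s := Set.range b)
    (by rw [Submodule.dense_iff_topologicalClosure_eq_top]; exact b.dense_span)
    (by rintro _ ⟨i, rfl⟩; exact h i)

/-- Monomial unitaries: permute a Hilbert basis and multiply by phases. -/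
theorem HilbertBasis.exists_monomial [CompleteSpace L] (b : HilbertBasis I ℂ L)
    (τ : Equiv.Perm I) (u : I → ℂ)
    (hu : ∀ i, ‖u i‖ = 1) : ∃ W : L ≃ₗᵢ[ℂ] L, ∀ i, W (b i) = u i • b (τ i) := by
  classical
  have hv : Orthonormal ℂ fun i => u i • b (τ i) := by
    refine ⟨fun i => by simp [norm_smul, hu, b.orthonormal.1], fun i j hij => ?_⟩
    change ⟪u i • b (τ i), u j • b (τ j)⟫_ℂ = 0
    rw [inner_smul_left, inner_smul_right, b.orthonormal.2 (fun h => hij (τ.injective h))]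
    simp
  have hsp : ⊤ ≤ (Submodule.span ℂ (Set.range fun i => u i • b (τ i))).topologicalClosure := by
    rw [← b.dense_span]
    refine Submodule.topologicalClosure_mono (Submodule.span_le.2 ?_)
    rintro _ ⟨i, rfl⟩
    have hne : u (τ.symm i) ≠ 0 := fun h => by simpa [h] using hu (τ.symm i)
    have : b i = (u (τ.symm i))⁻¹ • (u (τ.symm i) • b (τ (τ.symm i))) := by
      rw [smul_smul, inv_mul_cancel₀ hne, one_smul, Equiv.apply_symm_apply]
    rw [this]
    exact Submodule.smul_mem _ _ (Submodule.subset_span ⟨τ.symm i, rfl⟩)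
  refine ⟨b.repr.trans (HilbertBasis.mk hv hsp).repr.symm, fun i => ?_⟩
  rw [LinearIsometryEquiv.trans_apply, b.repr_self, HilbertBasis.repr_symm_single,
    HilbertBasis.coe_mk]

/-- Schur test: a family whose Gram matrix is dominated by a summable convolution kernel is a
Bessel family. -/
theorem sum_norm_inner_sq_le_of_gram_le [AddCommGroup I] {v : I → H} {a : I → ℝ} (ha : Summable a)
    (hv : ∀ i j, ‖⟪v i, v j⟫_ℂ‖ ≤ a (j - i)) (f : H) (F : Finset I) :
    ∑ i ∈ F, ‖⟪v i, f⟫_ℂ‖ ^ 2 ≤ (∑' i, a i) * ‖f‖ ^ 2 := by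
  classical
  set A := ∑' i, a i with hA
  have ha0 : ∀ i, 0 ≤ a i := fun i => by
    simpa using (norm_nonneg _).trans (hv 0 i)
  have hA0 : 0 ≤ A := tsum_nonneg ha0
  have hcol : ∀ i, ∑ j ∈ F, a (j - i) ≤ A := fun i => by
    rw [← Finset.sum_image (f := a) (g := fun j => j - i) (by simp)]
    exact ha.sum_le_tsum _ fun _ _ => ha0 _
  have hrow : ∀ j, ∑ i ∈ F, a (j - i) ≤ A := fun j => by
    rw [← Finset.sum_image (f := a) (g := fun i => j - i) (by simp)]
    exact ha.sum_le_tsum _ fun _ _ => ha0 _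
  set c : I → ℂ := fun i => ⟪v i, f⟫_ℂ with hc
  set s : ℝ := ∑ i ∈ F, ‖c i‖ ^ 2 with hs
  have hs0 : 0 ≤ s := by positivity
  set w : H := ∑ i ∈ F, c i • v i with hw
  have hwf : ⟪w, f⟫_ℂ = s := by
    rw [hw, sum_inner, hs]
    push_cast
    refine Finset.sum_congr rfl fun i _ => ?_
    rw [inner_smul_left, Complex.conj_mul']
  have hww : ‖w‖ ^ 2 ≤ A * s := by
    have h1 : ‖w‖ ^ 2 = ‖⟪w, w⟫_ℂ‖ := by
      rw [inner_self_eq_norm_sq_to_K]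
      simp
    have h2 : ⟪w, w⟫_ℂ = ∑ i ∈ F, ∑ j ∈ F, (starRingEnd ℂ) (c i) * (c j * ⟪v i, v j⟫_ℂ) := by
      rw [hw, sum_inner]
      refine Finset.sum_congr rfl fun i _ => ?_
      rw [inner_sum]
      refine Finset.sum_congr rfl fun j _ => ?_
      rw [inner_smul_left, inner_smul_right]
    have h3 : ∀ i j, ‖(starRingEnd ℂ) (c i) * (c j * ⟪v i, v j⟫_ℂ)‖ ≤
        2⁻¹ * (‖c i‖ ^ 2 * a (j - i)) + 2⁻¹ * (‖c j‖ ^ 2 * a (j - i)) := fun i j => by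
      rw [norm_mul, norm_mul, RCLike.norm_conj, ← mul_assoc]
      calc ‖c i‖ * ‖c j‖ * ‖⟪v i, v j⟫_ℂ‖ ≤ ‖c i‖ * ‖c j‖ * a (j - i) := by
            gcongr; exact hv i j
        _ ≤ (2⁻¹ * (‖c i‖ ^ 2 + ‖c j‖ ^ 2)) * a (j - i) := by
            refine mul_le_mul_of_nonneg_right ?_ (ha0 _)
            nlinarith [sq_nonneg (‖c i‖ - ‖c j‖)]
        _ = _ := by ring
    rw [h1, h2]
    calc _ ≤ ∑ i ∈ F, ∑ j ∈ F, (2⁻¹ * (‖c i‖ ^ 2 * a (j - i)) + 2⁻¹ * (‖c j‖ ^ 2 * a (j - i))) :=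
          (norm_sum_le _ _).trans <| Finset.sum_le_sum fun i _ => (norm_sum_le _ _).trans <|
            Finset.sum_le_sum fun j _ => h3 i j
      _ = 2⁻¹ * (∑ i ∈ F, ‖c i‖ ^ 2 * ∑ j ∈ F, a (j - i)) +
          2⁻¹ * (∑ j ∈ F, ‖c j‖ ^ 2 * ∑ i ∈ F, a (j - i)) := by
          simp_rw [Finset.sum_add_distrib, Finset.mul_sum]
          congr 1
          exact Finset.sum_comm
      _ ≤ 2⁻¹ * (∑ i ∈ F, ‖c i‖ ^ 2 * A) + 2⁻¹ * (∑ j ∈ F, ‖c j‖ ^ 2 * A) := by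
          gcongr with i _ j _
          · exact hcol i
          · exact hrow j
      _ = A * s := by
          rw [← Finset.sum_mul, ← hs]
          ring
  have hsq : s ^ 2 ≤ A * s * ‖f‖ ^ 2 := by
    have : s ≤ ‖w‖ * ‖f‖ := by
      have := norm_inner_le_norm (𝕜 := ℂ) w f
      rwa [hwf, Complex.norm_real, Real.norm_of_nonneg hs0] at this
    calc s ^ 2 ≤ (‖w‖ * ‖f‖) ^ 2 := by gcongr
      _ = ‖w‖ ^ 2 * ‖f‖ ^ 2 := by ring
      _ ≤ _ := by gcongr
  rcases hs0.eq_or_lt with h | h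
  · rw [← h]
    positivity
  · nlinarith

/-- The synthesis operator of a family satisfying the Schur test. -/
theorem HilbertBasis.exists_synthesis [CompleteSpace L] [CompleteSpace H] [AddCommGroup I]
    (b : HilbertBasis I ℂ L) {v : I → H} {a : I → ℝ}
    (ha : Summable a) (hv : ∀ i j, ‖⟪v i, v j⟫_ℂ‖ ≤ a (j - i)) :
    ∃ T : L →L[ℂ] H, ∀ i, T (b i) = v i := by
  classical
  have hsum := sum_norm_inner_sq_le_of_gram_le ha hv
  have hA0 : 0 ≤ ∑' i, a i := tsum_nonneg fun i => by
    simpa using (norm_nonneg _).trans (hv 0 i)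
  have hmem : ∀ f, Memℓp (fun i => ⟪v i, f⟫_ℂ) 2 := fun f =>
    memℓp_gen' (C := (∑' i, a i) * ‖f‖ ^ 2) fun F => by simpa using hsum f F
  let B : H →L[ℂ] lp (fun _ : I => ℂ) 2 := LinearMap.mkContinuous
    { toFun := fun f => ⟨fun i => ⟪v i, f⟫_ℂ, hmem f⟩
      map_add' := fun f f' => by ext i; exact inner_add_right _ _ _
      map_smul' := fun c f => by ext i; exact inner_smul_right _ _ _ } (√(∑' i, a i)) fun f => by
      refine lp.norm_le_of_forall_sum_le (by simp) (by positivity) fun F => ?_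
      have := hsum f F
      simp only [LinearMap.coe_mk, AddHom.coe_mk, ENNReal.toReal_ofNat, Real.rpow_ofNat]
      rwa [mul_pow, Real.sq_sqrt hA0]
  have hB : ∀ f i, B f i = ⟪v i, f⟫_ℂ := fun _ _ => rfl
  refine ⟨adjoint B ∘L b.repr.toContinuousLinearEquiv.toContinuousLinearMap, fun i => ?_⟩
  refine ext_inner_right ℂ fun f => ?_
  simp only [comp_apply, adjoint_inner_left]
  rw [← hB]
  change ⟪b.repr (b i), B f⟫_ℂ = _
  rw [b.repr_self, lp.inner_single_left]
  simp

end HilbertBases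

section UnitCube

open Set
open scoped FourierTransform ENNReal

variable {ι : Type*}

/-- The real vector with the given integer coordinates. -/
def intVec (m : ι → ℤ) : ι → ℝ := fun i => (m i : ℝ)

theorem intVec_add (m n : ι → ℤ) : intVec (m + n) = intVec m + intVec n := by
  ext i; simp [intVec]

theorem intVec_neg (m : ι → ℤ) : intVec (-m) = -intVec m := by
  ext i; simp [intVec]

theorem intVec_zero : intVec (0 : ι → ℤ) = 0 := by
  ext i; simp [intVec]

variable (ι) in
/-- The half-open unit cube. -/
def unitCube : Set (ι → ℝ) := univ.pi fun _ => Ico 0 1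

theorem add_intVec_floor_eq_iff {s : ι → ℝ} {m : ι → ℤ} :
    (∀ i, ⌊(s + intVec m) i⌋ = m i) ↔ s ∈ unitCube ι := by
  simp only [unitCube, mem_univ_pi, mem_Ico, Pi.add_apply, intVec, Int.floor_add_intCast,
    add_eq_right, Int.floor_eq_zero_iff]

variable [Fintype ι]

theorem measurableSet_unitCube : MeasurableSet (unitCube ι) :=
  MeasurableSet.univ_pi fun _ => measurableSet_Ico

theorem volume_unitCube : volume (unitCube ι) = 1 := by
  simp [unitCube, volume_pi_pi]

instance : IsProbabilityMeasure (volume.restrict (unitCube ι)) :=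
  ⟨by simp [volume_unitCube]⟩

theorem lintegral_eq_setLIntegral_unitCube_tsum {F : (ι → ℝ) → ℝ≥0∞} (hF : Measurable F) :
    ∫⁻ s, F s = ∫⁻ s in unitCube ι, ∑' m : ι → ℤ, F (s + intVec m) := by
  set A : (ι → ℤ) → Set (ι → ℝ) := fun m => {s | ∀ i, ⌊s i⌋ = m i} with hA
  have hAm : ∀ m, MeasurableSet (A m) := fun m => by
    have : A m = (fun (s : ι → ℝ) i => ⌊s i⌋) ⁻¹' {m} := by
      ext s; simp [hA, funext_iff]
    rw [this]
    exact (measurable_pi_lambda _ fun i => Int.measurable_floor.comp (measurable_pi_apply i))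
      (measurableSet_singleton m)
  have hU : ⋃ m, A m = univ := eq_univ_of_forall fun s => mem_iUnion.2 ⟨fun i => ⌊s i⌋, fun _ => rfl⟩
  have hd : Pairwise (Function.onFun Disjoint A) := fun m n hmn =>
    disjoint_left.2 fun s hs hs' => hmn (funext fun i => (hs i).symm.trans (hs' i))
  have hsum := lintegral_tsum (μ := volume.restrict (unitCube ι))
    (f := fun (m : ι → ℤ) s => F (s + intVec m))
    fun m => (hF.comp (measurable_add_const _)).aemeasurable
  rw [hsum, ← setLIntegral_univ, ← hU, lintegral_iUnion hAm hd]
  refine tsum_congr fun m => ?_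
  rw [← lintegral_indicator (hAm m), ← lintegral_indicator measurableSet_unitCube,
    ← lintegral_add_right_eq_self _ (intVec m)]
  refine lintegral_congr fun s => ?_
  by_cases hs : s ∈ unitCube ι
  · have h : s + intVec m ∈ A m := add_intVec_floor_eq_iff.2 hs
    rw [indicator_of_mem hs, indicator_of_mem h]
  · have h : s + intVec m ∉ A m := fun h => hs (add_intVec_floor_eq_iff.1 h)
    rw [indicator_of_notMem hs, indicator_of_notMem h]

theorem integral_fourierChar_intCast_Ico {n : ℤ} (hn : n ≠ 0) :
    ∫ x in Ico (0 : ℝ) 1, (𝐞 (n * x) : ℂ) = 0 := by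
  rw [integral_Ico_eq_integral_Ioc, ← intervalIntegral.integral_of_le zero_le_one]
  have hc : (2 * Real.pi * Complex.I * n : ℂ) ≠ 0 := by
    simp [Real.pi_ne_zero, hn]
  have : ∀ x : ℝ, (𝐞 (n * x) : ℂ) = Complex.exp ((2 * Real.pi * Complex.I * n) * x) := fun x => by
    rw [Real.fourierChar_apply]
    push_cast
    ring_nf
  simp_rw [this]
  rw [integral_exp_mul_complex hc]
  have h1 : Complex.exp ((2 * Real.pi * Complex.I * n) * (1 : ℝ)) = 1 := by
    rw [Complex.ofReal_one, mul_one, Complex.exp_eq_one_iff]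
    exact ⟨n, by ring⟩
  rw [h1]
  simp

theorem integral_unitCube_fourierChar_eq_zero {φ : (ι → ℝ) →ₗ[ℝ] ℝ} (hφ : φ ≠ 0)
    (hφk : ∀ k : ι → ℤ, 𝐞 (φ (intVec k)) = 1) :
    ∫ s in unitCube ι, (𝐞 (φ s) : ℂ) = 0 := by
  classical
  have hn : ∀ i, ∃ n : ℤ, φ (Pi.single i 1) = n := fun i => by
    have h := hφk (Pi.single i 1)
    have hi : intVec (Pi.single i 1) = (Pi.single i 1 : ι → ℝ) := by
      ext j
      by_cases hj : j = i
      · subst hj; simp [intVec]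
      · simp [intVec, hj]
    rw [hi] at h
    have h' := congrArg (fun z : Circle => (z : ℂ)) h
    simp only [Real.fourierChar_apply, Circle.coe_one, Complex.exp_eq_one_iff] at h'
    obtain ⟨n, hn⟩ := h'
    refine ⟨n, ?_⟩
    have hc : (2 * Real.pi * Complex.I : ℂ) ≠ 0 := by simp [Real.pi_ne_zero]
    have : ((φ (Pi.single i 1) : ℝ) : ℂ) = n := by
      apply mul_left_cancel₀ hc
      rw [mul_comm _ (n : ℂ), ← hn]
      push_cast
      ring
    exact_mod_cast this
  choose n hn using hn
  have hφs : ∀ s, φ s = ∑ i, n i * s i := fun s => by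
    conv_lhs => rw [pi_eq_sum_univ' s]
    simp [hn, mul_comm]
  obtain ⟨i, hi⟩ : ∃ i, n i ≠ 0 := by
    by_contra! h
    exact hφ (LinearMap.ext fun s => by simp [hφs, h])
  have hprod : ∀ s, (𝐞 (φ s) : ℂ) = ∏ i, (𝐞 (n i * s i) : ℂ) := fun s => by
    rw [hφs]
    simp only [Real.fourierChar_apply]
    rw [← Complex.exp_sum]
    congr 1
    push_cast
    rw [Finset.mul_sum, Finset.sum_mul]
  simp_rw [hprod]
  rw [unitCube, volume_pi, Measure.restrict_pi_pi,
    integral_fintype_prod_eq_prod (fun i (x : ℝ) => (𝐞 (n i * x) : ℂ))]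
  exact Finset.prod_eq_zero (Finset.mem_univ i) (integral_fourierChar_intCast_Ico hi)

end UnitCube

section ProjectiveRepresentation

open ContinuousLinearMap InnerProductSpace Set
open scoped InnerProductSpace ENNReal FourierTransform

theorem apply_adjoint_apply_eq_self {L H : Type*} [NormedAddCommGroup L] [InnerProductSpace ℂ L]
    [CompleteSpace L] [NormedAddCommGroup H] [InnerProductSpace ℂ H] [CompleteSpace H]
    {T : L →L[ℂ] H} (hT1 : ‖T‖ ≤ 1) {y : H} (hy : ‖y‖ ≤ ‖adjoint T y‖) :
    T (adjoint T y) = y := by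
  have h1 : ‖T (adjoint T y)‖ ≤ ‖adjoint T y‖ := apply_le_of_norm_le_one hT1 _
  have h2 : RCLike.re ⟪T (adjoint T y), y⟫_ℂ = ‖adjoint T y‖ ^ 2 := by
    rw [← adjoint_inner_right, inner_self_eq_norm_sq]
  have h3 := norm_sub_sq (𝕜 := ℂ) (T (adjoint T y)) y
  rw [h2] at h3
  have h4 : ‖T (adjoint T y) - y‖ ^ 2 ≤ 0 := by
    rw [h3]
    nlinarith [norm_nonneg (T (adjoint T y)), norm_nonneg y, norm_nonneg (adjoint T y)]
  rw [← sub_eq_zero, ← norm_eq_zero]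
  exact pow_eq_zero_iff (two_ne_zero) |>.1 (le_antisymm h4 (by positivity))

theorem norm_fourierChar (x : ℝ) : ‖(𝐞 x : ℂ)‖ = 1 := Circle.norm_coe _

theorem intertwiners_conj {I L H : Type*} [NormedAddCommGroup L] [InnerProductSpace ℂ L]
    [NormedAddCommGroup H] [InnerProductSpace ℂ H] {l : I → L ≃ₗᵢ[ℂ] L} {r : I → H ≃ₗᵢ[ℂ] H}
    {V : L ≃ₗᵢ[ℂ] L} {W : H ≃ₗᵢ[ℂ] H}
    (h : ∀ j, ∃ c : ℂ, c ≠ 0 ∧ (∀ y, W (r j y) = c • r j (W y)) ∧ ∀ x, V (l j x) = c • l j (V x))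
    {S : L →L[ℂ] H} (hS : S ∈ intertwiners l r) :
    W.toContinuousLinearEquiv.toContinuousLinearMap ∘L S ∘L
      V.symm.toContinuousLinearEquiv.toContinuousLinearMap ∈ intertwiners l r := fun j x => by
  obtain ⟨c, hc, hW, hV⟩ := h j
  have : V.symm (l j x) = c⁻¹ • l j (V.symm x) := by
    apply V.injective
    simp [hV, smul_smul, inv_mul_cancel₀ hc]
  simp [this, hS j, hW, smul_smul, inv_mul_cancel₀ hc]

theorem intertwiners_conj_symm {I L H : Type*} [NormedAddCommGroup L] [InnerProductSpace ℂ L]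
    [NormedAddCommGroup H] [InnerProductSpace ℂ H] {l : I → L ≃ₗᵢ[ℂ] L} {r : I → H ≃ₗᵢ[ℂ] H}
    {V : L ≃ₗᵢ[ℂ] L} {W : H ≃ₗᵢ[ℂ] H}
    (h : ∀ j, ∃ c : ℂ, c ≠ 0 ∧ (∀ y, W (r j y) = c • r j (W y)) ∧ ∀ x, V (l j x) = c • l j (V x))
    {S : L →L[ℂ] H} (hS : S ∈ intertwiners l r) :
    W.symm.toContinuousLinearEquiv.toContinuousLinearMap ∘L S ∘L
      V.toContinuousLinearEquiv.toContinuousLinearMap ∈ intertwiners l r := fun j x => by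
  obtain ⟨c, hc, hW, hV⟩ := h j
  have : W.symm (r j (S (V x))) = c⁻¹ • r j (W.symm (S (V x))) := by
    apply W.injective
    simp [hW, smul_smul, inv_mul_cancel₀ hc]
  simp [this, hS j, hV, smul_smul, mul_inv_cancel₀ hc]

theorem starProjection_defectKernel_commute {I L H : Type*} [NormedAddCommGroup L]
    [InnerProductSpace ℂ L] [CompleteSpace L] [NormedAddCommGroup H] [InnerProductSpace ℂ H]
    [CompleteSpace H] {l : I → L ≃ₗᵢ[ℂ] L} {r : I → H ≃ₗᵢ[ℂ] H} {T : L →L[ℂ] H}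
    (hT : T ∈ intertwiners l r) {V : L ≃ₗᵢ[ℂ] L} {k : I}
    (h : ∀ j, ∃ c : ℂ, c ≠ 0 ∧ (∀ y, r k (r j y) = c • r j (r k y)) ∧
      ∀ x, V (l j x) = c • l j (V x)) (x : L) :
    (defectKernel l r T)ᗮ.starProjection (V x) = V ((defectKernel l r T)ᗮ.starProjection x) :=
  starProjection_defectKernel_twist hT (fun _ hS => intertwiners_conj h hS)
    (fun _ hS => intertwiners_conj_symm h hS) x

variable {ι : Type*} [Fintype ι]

/-- The mean over the unit cube of a nonnegative trigonometric series whose nonconstant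
characters are periodic. -/
theorem setLIntegral_unitCube_of_hasSum {F : (ι → ℝ) → ℝ} (hF : ∀ s, 0 ≤ F s)
    {a : (ι → ℤ) → ℂ} (ha : Summable fun m => ‖a m‖) {φ : (ι → ℤ) → (ι → ℝ) →ₗ[ℝ] ℝ}
    (hsum : ∀ s, HasSum (fun m => a m * 𝐞 (φ m s)) (F s : ℂ)) (h0 : φ 0 = 0)
    (hφ : ∀ m ≠ 0, a m = 0 ∨ (φ m ≠ 0 ∧ ∀ k : ι → ℤ, 𝐞 (φ m (intVec k)) = 1)) :
    Continuous F ∧ ∫⁻ s in unitCube ι, ENNReal.ofReal (F s) = ENNReal.ofReal (a 0).re := by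
  have hc : ∀ m, Continuous fun s => a m * (𝐞 (φ m s) : ℂ) := fun m => by
    have : Continuous (φ m) := LinearMap.continuous_of_finiteDimensional _
    have h2 := Real.continuous_fourierChar.comp this
    exact continuous_const.mul (continuous_subtype_val.comp h2)
  have hn : ∀ m s, ‖a m * (𝐞 (φ m s) : ℂ)‖ = ‖a m‖ := fun m s => by
    rw [norm_mul, norm_fourierChar, mul_one]
  have hFc : Continuous fun s => (F s : ℂ) := by
    have : (fun s => (F s : ℂ)) = fun s => ∑' m, a m * (𝐞 (φ m s) : ℂ) :=
      funext fun s => (hsum s).tsum_eq.symm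
    rw [this]
    exact continuous_tsum hc ha fun m s => (hn m s).le
  have hFc' : Continuous F := by
    exact Complex.continuous_re.comp hFc
  refine ⟨hFc', ?_⟩
  have hi : ∀ m, Integrable (fun s => a m * (𝐞 (φ m s) : ℂ)) (volume.restrict (unitCube ι)) :=
    fun m => Integrable.of_bound (hc m).aestronglyMeasurable ‖a m‖ (.of_forall fun s => (hn m s).le)
  have hI : ∫ s in unitCube ι, (F s : ℂ) = a 0 := by
    have h := hasSum_integral_of_summable_integral_norm hi (by
      simp only [hn]
      simpa using ha)
    have h2 : ∀ m, m ≠ 0 → ∫ s in unitCube ι, a m * (𝐞 (φ m s) : ℂ) = 0 := fun m hm => by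
      rw [integral_const_mul]
      rcases hφ m hm with h | ⟨h, h'⟩
      · simp [h]
      · rw [integral_unitCube_fourierChar_eq_zero h h', mul_zero]
    have h3 := (hasSum_single 0 h2).unique h
    simp only [fun s => (hsum s).tsum_eq] at h3
    rw [← h3]
    simp [h0]
  have hFi : Integrable F (volume.restrict (unitCube ι)) := by
    refine Integrable.of_bound hFc'.aestronglyMeasurable (∑' m, ‖a m‖) (.of_forall fun s => ?_)
    have h := norm_tsum_le_tsum_norm (f := fun m => a m * (𝐞 (φ m s) : ℂ)) (by
      simpa only [hn] using ha)
    rw [(hsum s).tsum_eq] at h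
    simpa only [hn, Complex.norm_real] using h
  rw [← ofReal_integral_eq_lintegral_ofReal hFi (.of_forall hF)]
  congr 1
  rw [← hI, integral_complex_ofReal, Complex.ofReal_re]

variable {H : Type*} [NormedAddCommGroup H] [InnerProductSpace ℂ H]
  {ρ : (ι → ℝ) → H ≃ₗᵢ[ℂ] H} {B : (ι → ℝ) →ₗ[ℝ] (ι → ℝ) →ₗ[ℝ] ℝ}

theorem projRep_zero (hρ : ∀ s t x, ρ s (ρ t x) = (𝐞 (B s t) : ℂ) • ρ (s + t) x) (x : H) :
    ρ 0 x = x := by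
  have := hρ 0 0 x
  simp only [map_zero, add_zero, AddChar.map_zero_eq_one, Circle.coe_one, one_smul] at this
  exact (ρ 0).injective this

theorem projRep_comm (hρ : ∀ s t x, ρ s (ρ t x) = (𝐞 (B s t) : ℂ) • ρ (s + t) x) (s t : ι → ℝ)
    (x : H) : ρ s (ρ t x) = (𝐞 (B s t - B t s) : ℂ) • ρ t (ρ s x) := by
  rw [hρ s t, hρ t s, smul_smul, ← Circle.coe_mul, ← AddChar.map_add_eq_mul, sub_add_cancel,
    add_comm t]

theorem enorm_inner_projRep (hρ : ∀ s t x, ρ s (ρ t x) = (𝐞 (B s t) : ℂ) • ρ (s + t) x)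
    (s t : ι → ℝ) (x y : H) : ‖⟪x, ρ (s + t) y⟫_ℂ‖ₑ = ‖⟪x, ρ s (ρ t y)⟫_ℂ‖ₑ := by
  rw [hρ, inner_smul_right, enorm_mul]
  simp only [← ofReal_norm, norm_fourierChar, ENNReal.ofReal_one, one_mul]

theorem enorm_inner_projRep_neg (hρ : ∀ s t x, ρ s (ρ t x) = (𝐞 (B s t) : ℂ) • ρ (s + t) x)
    (s : ι → ℝ) (x y : H) : ‖⟪ρ (-s) x, y⟫_ℂ‖ₑ = ‖⟪x, ρ s y⟫_ℂ‖ₑ := by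
  rw [← LinearIsometryEquiv.inner_map_map (ρ s) (ρ (-s) x), hρ, add_neg_cancel, projRep_zero hρ,
    inner_smul_left, enorm_mul]
  simp only [← ofReal_norm, norm_fourierChar, RCLike.norm_conj, ENNReal.ofReal_one, one_mul]

variable {g : H} {c : ℝ≥0∞}

theorem setLIntegral_tsum_enorm_inner_projRep
    (hρ : ∀ s t x, ρ s (ρ t x) = (𝐞 (B s t) : ℂ) • ρ (s + t) x)
    (hmeas : ∀ f, Measurable fun s => ⟪f, ρ s g⟫_ℂ)
    (hM : ∀ f, ∫⁻ s, ‖⟪f, ρ s g⟫_ℂ‖ₑ ^ 2 = c * ‖f‖ₑ ^ 2 * ‖g‖ₑ ^ 2) (f : H) :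
    ∫⁻ s in unitCube ι, ∑' m : ι → ℤ, ‖⟪ρ (intVec m) f, ρ s g⟫_ℂ‖ₑ ^ 2 =
      c * ‖f‖ₑ ^ 2 * ‖g‖ₑ ^ 2 := by
  rw [← hM f, lintegral_eq_setLIntegral_unitCube_tsum ((hmeas f).enorm.pow_const 2)]
  refine lintegral_congr fun s => ?_
  rw [← (Equiv.neg (ι → ℤ)).tsum_eq]
  refine tsum_congr fun m => ?_
  rw [Equiv.neg_apply, intVec_neg, enorm_inner_projRep_neg hρ, add_comm, enorm_inner_projRep hρ]

/-- If some orbit of the integer lattice is a Hilbert basis, the density is one. -/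
theorem eq_one_of_hilbertBasis_projRep
    (hρ : ∀ s t x, ρ s (ρ t x) = (𝐞 (B s t) : ℂ) • ρ (s + t) x) (hg : g ≠ 0)
    (hmeas : ∀ f, Measurable fun s => ⟪f, ρ s g⟫_ℂ)
    (hM : ∀ f, ∫⁻ s, ‖⟪f, ρ s g⟫_ℂ‖ₑ ^ 2 = c * ‖f‖ₑ ^ 2 * ‖g‖ₑ ^ 2) {h : H}
    (b : HilbertBasis (ι → ℤ) ℂ H) (hb : ∀ m, b m = ρ (intVec m) h) : c = 1 := by
  have h1 : ‖h‖ₑ = 1 := by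
    have := b.orthonormal.1 0
    rw [hb, LinearIsometryEquiv.norm_map] at this
    rw [← ofReal_norm, this, ENNReal.ofReal_one]
  have h2 := setLIntegral_tsum_enorm_inner_projRep hρ hmeas hM h
  simp_rw [← hb, HilbertBasis.tsum_enorm_inner_sq b, LinearIsometryEquiv.enorm_map, h1] at h2
  simp only [lintegral_const, measure_univ, mul_one, one_pow] at h2
  have h3 : ‖g‖ₑ ^ 2 ≠ 0 := by simpa using hg
  have h4 : ‖g‖ₑ ^ 2 ≠ ∞ := by simp
  exact ((ENNReal.mul_eq_right h3 h4).1 h2.symm)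

end ProjectiveRepresentation

section ExistenceOfBasis

open ContinuousLinearMap InnerProductSpace Set
open scoped InnerProductSpace ENNReal FourierTransform

variable {ι : Type*} [Fintype ι] {L H : Type*}
  [NormedAddCommGroup L] [InnerProductSpace ℂ L] [CompleteSpace L]
  [NormedAddCommGroup H] [InnerProductSpace ℂ H] [CompleteSpace H]
  {ρ : (ι → ℝ) → H ≃ₗᵢ[ℂ] H} {B : (ι → ℝ) →ₗ[ℝ] (ι → ℝ) →ₗ[ℝ] ℝ}
  {b : HilbertBasis (ι → ℤ) ℂ L} {l : (ι → ℤ) → L ≃ₗᵢ[ℂ] L} {V : (ι → ℤ) → L ≃ₗᵢ[ℂ] L}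

theorem fourierChar_smul_smul (x y : ℝ) (v : L) :
    (𝐞 x : ℂ) • (𝐞 y : ℂ) • v = (𝐞 (x + y) : ℂ) • v := by
  rw [smul_smul, AddChar.map_add_eq_mul, Circle.coe_mul]

/-- The twisted translations of a Hilbert basis satisfy the same commutation relations as a
projective representation restricted to the integer lattice. -/
theorem twistedTranslation_comm
    (hl : ∀ k m, l k (b m) = (𝐞 (B (intVec k) (intVec m)) : ℂ) • b (k + m)) (k j : ι → ℤ) (x : L) :
    l k (l j x) =
      (𝐞 (B (intVec k) (intVec j) - B (intVec j) (intVec k)) : ℂ) • l j (l k x) := by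
  have := b.ext_continuousLinearMap
    (S := (l k).toContinuousLinearEquiv.toContinuousLinearMap ∘L
      (l j).toContinuousLinearEquiv.toContinuousLinearMap)
    (T := (𝐞 (B (intVec k) (intVec j) - B (intVec j) (intVec k)) : ℂ) •
      ((l j).toContinuousLinearEquiv.toContinuousLinearMap ∘L
      (l k).toContinuousLinearEquiv.toContinuousLinearMap)) fun m => by
    simp only [coe_comp, Function.comp_apply, ContinuousLinearEquiv.coe_coe,
      LinearIsometryEquiv.coe_toContinuousLinearEquiv, hl, map_smul, smul_apply,
      fourierChar_smul_smul, intVec_add, map_add]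
    rw [add_left_comm j k m]
    congr 3
    ring
  exact congrArg (fun S => S x) this

theorem multiplier_comm
    (hl : ∀ k m, l k (b m) = (𝐞 (B (intVec k) (intVec m)) : ℂ) • b (k + m))
    (hV : ∀ k m, V k (b m) =
      (𝐞 (B (intVec k) (intVec m) - B (intVec m) (intVec k)) : ℂ) • b m) (k j : ι → ℤ) (x : L) :
    V k (l j x) =
      (𝐞 (B (intVec k) (intVec j) - B (intVec j) (intVec k)) : ℂ) • l j (V k x) := by
  have := b.ext_continuousLinearMap
    (S := (V k).toContinuousLinearEquiv.toContinuousLinearMap ∘L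
      (l j).toContinuousLinearEquiv.toContinuousLinearMap)
    (T := (𝐞 (B (intVec k) (intVec j) - B (intVec j) (intVec k)) : ℂ) •
      ((l j).toContinuousLinearEquiv.toContinuousLinearMap ∘L
      (V k).toContinuousLinearEquiv.toContinuousLinearMap)) fun m => by
    simp only [coe_comp, Function.comp_apply, ContinuousLinearEquiv.coe_coe,
      LinearIsometryEquiv.coe_toContinuousLinearEquiv, hl, hV, map_smul, smul_apply,
      fourierChar_smul_smul, intVec_add, map_add, LinearMap.add_apply]
    congr 3
    ring
  exact congrArg (fun S => S x) this

theorem mem_intertwiners_iff_apply_basis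
    (hρ : ∀ s t x, ρ s (ρ t x) = (𝐞 (B s t) : ℂ) • ρ (s + t) x)
    (hl : ∀ k m, l k (b m) = (𝐞 (B (intVec k) (intVec m)) : ℂ) • b (k + m)) {S : L →L[ℂ] H} :
    S ∈ intertwiners l (fun k => ρ (intVec k)) ↔ ∀ m, S (b m) = ρ (intVec m) (S (b 0)) := by
  constructor
  · intro hS m
    rw [← hS m, hl m 0]
    simp [intVec_zero]
  · intro h k x
    have := b.ext_continuousLinearMap
      (S := S ∘L (l k).toContinuousLinearEquiv.toContinuousLinearMap)
      (T := (ρ (intVec k)).toContinuousLinearEquiv.toContinuousLinearMap ∘L S) fun m => by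
      simp only [coe_comp, Function.comp_apply, ContinuousLinearEquiv.coe_coe,
        LinearIsometryEquiv.coe_toContinuousLinearEquiv, hl, map_smul]
      rw [h (k + m), h m, hρ, intVec_add]
    exact congrArg (fun S => S x) this

theorem enorm_sq_adjoint_apply_of_mem_intertwiners
    (hρ : ∀ s t x, ρ s (ρ t x) = (𝐞 (B s t) : ℂ) • ρ (s + t) x)
    (hl : ∀ k m, l k (b m) = (𝐞 (B (intVec k) (intVec m)) : ℂ) • b (k + m)) {S : L →L[ℂ] H}
    (hS : S ∈ intertwiners l (fun k => ρ (intVec k))) (y : H) :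
    ‖adjoint S y‖ₑ ^ 2 = ∑' m : ι → ℤ, ‖⟪ρ (intVec m) (S (b 0)), y⟫_ℂ‖ₑ ^ 2 := by
  rw [← b.tsum_enorm_inner_sq]
  refine tsum_congr fun m => ?_
  rw [adjoint_inner_right, (mem_intertwiners_iff_apply_basis hρ hl).1 hS m]

variable {g : H}

/-- The integral over the unit cube of the norm of the central support. -/
theorem setLIntegral_enorm_sq_starProjection
    (hρ : ∀ s t x, ρ s (ρ t x) = (𝐞 (B s t) : ℂ) • ρ (s + t) x)
    (hl : ∀ k m, l k (b m) = (𝐞 (B (intVec k) (intVec m)) : ℂ) • b (k + m))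
    (hV : ∀ k m, V k (b m) =
      (𝐞 (B (intVec k) (intVec m) - B (intVec m) (intVec k)) : ℂ) • b m)
    (hsum : Summable fun m : ι → ℤ => ‖⟪g, ρ (intVec m) g⟫_ℂ‖)
    (hnd : ∀ m : ι → ℤ, (∀ s, B s (intVec m) = B (intVec m) s) → m = 0)
    {T : L →L[ℂ] H} (hT : T ∈ intertwiners l (fun k => ρ (intVec k)))
    {τ : (ι → ℝ) → L →L[ℂ] H} (hτ : ∀ s, τ s ∈ intertwiners l (fun k => ρ (intVec k)))
    (hτ0 : ∀ s, τ s (b 0) = ρ s g) :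
    Measurable (fun s => ‖(defectKernel' l (fun k => ρ (intVec k)) T)ᗮ.starProjection
      (ρ s g)‖ₑ ^ 2) ∧
    ∫⁻ s in unitCube ι, ‖(defectKernel' l (fun k => ρ (intVec k)) T)ᗮ.starProjection
      (ρ s g)‖ₑ ^ 2 =
      ‖(defectKernel l (fun k => ρ (intVec k)) T)ᗮ.starProjection (b 0)‖ₑ ^ 2 * ‖g‖ₑ ^ 2 := by
  set P := (defectKernel' l (fun k => ρ (intVec k)) T)ᗮ.starProjection with hP
  set Q := (defectKernel l (fun k => ρ (intVec k)) T)ᗮ.starProjection with hQ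
  have hPs : ∀ y z, ⟪P y, z⟫_ℂ = ⟪y, P z⟫_ℂ := fun y z => Submodule.inner_starProjection_left_eq_right _ y z
  have hPi : ∀ y, P (P y) = P y := fun y => starProjection_orthogonal_idem _ y
  have hQs : ∀ y z, ⟪Q y, z⟫_ℂ = ⟪y, Q z⟫_ℂ := fun y z => Submodule.inner_starProjection_left_eq_right _ y z
  have hQi : ∀ y, Q (Q y) = Q y := fun y => starProjection_orthogonal_idem _ y
  have hQV : ∀ k x, Q (V k x) = V k (Q x) := fun k x => by
    refine starProjection_defectKernel_commute hT (k := k) (fun j => ?_) x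
    exact ⟨_, Circle.coe_ne_zero _, projRep_comm hρ _ _, multiplier_comm hl hV k j⟩
  set q : (ι → ℤ) → ℂ := fun m => ⟪b m, Q (b 0)⟫_ℂ with hq
  have hq0 : q 0 = ((‖Q (b 0)‖ ^ 2 : ℝ) : ℂ) := by
    rw [hq]
    simp only
    rw [← hQi, ← hQs, inner_self_eq_norm_sq_to_K, hQi]
    simp
  have hq1 : ∀ m, ‖q m‖ ≤ 1 := fun m => by
    refine (norm_inner_le_norm _ _).trans ?_
    have h1 : ‖Q (b 0)‖ ≤ ‖b 0‖ := Submodule.norm_starProjection_apply_le _ _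
    have h2 := b.orthonormal.1
    rw [h2] at h1
    rw [h2, one_mul]
    exact h1
  have hqV : ∀ m, q m ≠ 0 → ∀ k : ι → ℤ,
      𝐞 (B (intVec k) (intVec m) - B (intVec m) (intVec k)) = 1 := fun m hm k => by
    have h0 : V k (b 0) = b 0 := by rw [hV]; simp [intVec_zero]
    have h1 : ⟪V k (b m), V k (Q (b 0))⟫_ℂ = q m := LinearIsometryEquiv.inner_map_map _ _ _
    rw [← hQV, h0, hV, inner_smul_left] at h1
    have h2 := mul_eq_right₀ hm |>.1 h1
    have h3 := congrArg (starRingEnd ℂ) h2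
    rw [Complex.conj_conj, map_one] at h3
    exact Circle.ext h3
  let φ : (ι → ℤ) → (ι → ℝ) →ₗ[ℝ] ℝ := fun m => B (intVec m) - B.flip (intVec m)
  have hφ : ∀ m s, φ m s = B (intVec m) s - B s (intVec m) := fun _ _ => rfl
  have hexp : ∀ s, HasSum (fun m => (q m * ⟪g, ρ (intVec m) g⟫_ℂ) * 𝐞 (φ m s))
      ((‖P (ρ s g)‖ ^ 2 : ℝ) : ℂ) := fun s => by
    have h1 := (b.hasSum_repr (Q (b 0))).mapL (innerSL ℂ (ρ s g) ∘L τ s)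
    have h2 : (innerSL ℂ (ρ s g) ∘L τ s) (Q (b 0)) = ((‖P (ρ s g)‖ ^ 2 : ℝ) : ℂ) := by
      change ⟪ρ s g, τ s (Q (b 0))⟫_ℂ = _
      rw [← starProjection_defectKernel_apply (hτ s), hτ0]
      change ⟪ρ s g, P (ρ s g)⟫_ℂ = _
      rw [← hPi, ← hPs, inner_self_eq_norm_sq_to_K, hPi]
      simp
    rw [h2] at h1
    convert! h1 using 2 with m
    change _ = ⟪ρ s g, τ s (b.repr (Q (b 0)) m • b m)⟫_ℂ
    rw [map_smul, inner_smul_right, b.repr_apply_apply,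
      (mem_intertwiners_iff_apply_basis hρ hl).1 (hτ s) m, hτ0, projRep_comm hρ, inner_smul_right,
      LinearIsometryEquiv.inner_map_map, hφ]
    ring
  obtain ⟨hc, hI⟩ := setLIntegral_unitCube_of_hasSum (fun s => by positivity)
    (Summable.of_nonneg_of_le (fun _ => norm_nonneg _) (fun m => by
      rw [norm_mul]
      exact mul_le_of_le_one_left (norm_nonneg _) (hq1 m)) hsum) hexp
    (by ext; simp [φ, intVec_zero]) (fun m hm => by
      by_cases h : q m = 0
      · left; rw [h, zero_mul]
      · right
        refine ⟨fun h0 => hm (hnd m fun s => ?_), fun k => ?_⟩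
        · have := hφ m s
          rw [h0, LinearMap.zero_apply] at this
          linarith
        · have := hqV m h k
          rw [hφ, ← neg_sub, AddChar.map_neg_eq_inv, this, inv_one])
  have he : ∀ v : H, ENNReal.ofReal (‖v‖ ^ 2) = ‖v‖ₑ ^ 2 := fun v => by
    rw [ENNReal.ofReal_pow (norm_nonneg _), ofReal_norm]
  have he' : ∀ v : L, ENNReal.ofReal (‖v‖ ^ 2) = ‖v‖ₑ ^ 2 := fun v => by
    rw [ENNReal.ofReal_pow (norm_nonneg _), ofReal_norm]
  simp_rw [he] at hI
  constructor
  · simp_rw [← he]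
    exact hc.measurable.ennreal_ofReal
  rw [hI, hq0, intVec_zero, projRep_zero hρ, inner_self_eq_norm_sq_to_K, ← he, ← he',
    ← ENNReal.ofReal_mul (by positivity)]
  congr 1
  have : ((‖g‖ : ℂ)) ^ 2 = ((‖g‖ ^ 2 : ℝ) : ℂ) := by norm_cast
  simp only [RCLike.ofReal_eq_complex_ofReal, this, Complex.re_ofReal_mul, Complex.ofReal_re]

end ExistenceOfBasis

section ExistenceOfBasis

open ContinuousLinearMap InnerProductSpace Set
open scoped InnerProductSpace ENNReal FourierTransform

variable {ι : Type*} [Fintype ι] {L H : Type*}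
  [NormedAddCommGroup L] [InnerProductSpace ℂ L] [CompleteSpace L]
  [NormedAddCommGroup H] [InnerProductSpace ℂ H] [CompleteSpace H]
  {ρ : (ι → ℝ) → H ≃ₗᵢ[ℂ] H} {B : (ι → ℝ) →ₗ[ℝ] (ι → ℝ) →ₗ[ℝ] ℝ} {g : H}
  {b : HilbertBasis (ι → ℤ) ℂ L} {l : (ι → ℤ) → L ≃ₗᵢ[ℂ] L}

theorem norm_inner_projRep (hρ : ∀ s t x, ρ s (ρ t x) = (𝐞 (B s t) : ℂ) • ρ (s + t) x)
    (s t : ι → ℝ) (x : H) : ‖⟪ρ s x, ρ t x⟫_ℂ‖ = ‖⟪x, ρ (t - s) x⟫_ℂ‖ := by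
  have h : ρ s (ρ (t - s) x) = (𝐞 (B s (t - s)) : ℂ) • ρ t x := by rw [hρ, add_sub_cancel]
  rw [← LinearIsometryEquiv.inner_map_map (ρ s) x, h, inner_smul_right, norm_mul,
    norm_fourierChar, one_mul]

/-- Analysis of the whole orbit of the window by one orbit of the integer lattice. -/
theorem setLIntegral_enorm_sq_adjoint_apply
    (hρ : ∀ s t x, ρ s (ρ t x) = (𝐞 (B s t) : ℂ) • ρ (s + t) x)
    (hmeas : ∀ f, Measurable fun s => ⟪f, ρ s g⟫_ℂ)
    (hM : ∀ f, ∫⁻ s, ‖⟪f, ρ s g⟫_ℂ‖ₑ ^ 2 = ‖f‖ₑ ^ 2 * ‖g‖ₑ ^ 2)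
    (hl : ∀ k m, l k (b m) = (𝐞 (B (intVec k) (intVec m)) : ℂ) • b (k + m)) {S : L →L[ℂ] H}
    (hS : S ∈ intertwiners l (fun k => ρ (intVec k))) :
    ∫⁻ s in unitCube ι, ‖adjoint S (ρ s g)‖ₑ ^ 2 = ‖S (b 0)‖ₑ ^ 2 * ‖g‖ₑ ^ 2 := by
  simp_rw [enorm_sq_adjoint_apply_of_mem_intertwiners hρ hl hS]
  rw [setLIntegral_tsum_enorm_inner_projRep (c := 1) hρ hmeas (by simpa using hM), one_mul]

theorem eq_zero_of_ae_inner_projRep_eq_zero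
    (hρ : ∀ s t x, ρ s (ρ t x) = (𝐞 (B s t) : ℂ) • ρ (s + t) x) (hg : g ≠ 0)
    (hmeas : ∀ f, Measurable fun s => ⟪f, ρ s g⟫_ℂ)
    (hM : ∀ f, ∫⁻ s, ‖⟪f, ρ s g⟫_ℂ‖ₑ ^ 2 = ‖f‖ₑ ^ 2 * ‖g‖ₑ ^ 2) {y : H}
    (hy : ∀ᵐ s ∂volume.restrict (unitCube ι), ∀ m : ι → ℤ, ⟪ρ (intVec m) y, ρ s g⟫_ℂ = 0) :
    y = 0 := by
  have h := setLIntegral_tsum_enorm_inner_projRep (c := 1) hρ hmeas (by simpa using hM) y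
  have h0 : ∫⁻ s in unitCube ι, ∑' m : ι → ℤ, ‖⟪ρ (intVec m) y, ρ s g⟫_ℂ‖ₑ ^ 2 = 0 := by
    rw [lintegral_congr_ae (g := 0), lintegral_zero_fun]
    filter_upwards [hy] with s hs
    simp [hs]
  rw [h0] at h
  simpa [hg] using h.symm

/-- If the density is one, some orbit of the integer lattice is an orthonormal basis. -/
theorem exists_orthonormal_orbit
    (hρ : ∀ s t x, ρ s (ρ t x) = (𝐞 (B s t) : ℂ) • ρ (s + t) x) (hg : g ≠ 0)
    (hmeas : ∀ f, Measurable fun s => ⟪f, ρ s g⟫_ℂ)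
    (hM : ∀ f, ∫⁻ s, ‖⟪f, ρ s g⟫_ℂ‖ₑ ^ 2 = ‖f‖ₑ ^ 2 * ‖g‖ₑ ^ 2)
    (hsum : Summable fun m : ι → ℤ => ‖⟪g, ρ (intVec m) g⟫_ℂ‖)
    (hnd : ∀ m : ι → ℤ, (∀ s, B s (intVec m) = B (intVec m) s) → m = 0) :
    ∃ h : H, Orthonormal ℂ (fun m : ι → ℤ => ρ (intVec m) h) ∧
      (Submodule.span ℂ (range fun m : ι → ℤ => ρ (intVec m) h)).topologicalClosure = ⊤ := by
  let b : HilbertBasis (ι → ℤ) ℂ (lp (fun _ : ι → ℤ => ℂ) 2) := default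
  choose l hl using fun k : ι → ℤ => b.exists_monomial (Equiv.addLeft k)
    (fun m => (𝐞 (B (intVec k) (intVec m)) : ℂ)) fun _ => norm_fourierChar _
  choose V hV using fun k : ι → ℤ => b.exists_monomial (Equiv.refl _)
    (fun m => (𝐞 (B (intVec k) (intVec m) - B (intVec m) (intVec k)) : ℂ))
    fun _ => norm_fourierChar _
  simp only [Equiv.coe_addLeft, Equiv.refl_apply] at hl hV
  set r : (ι → ℤ) → H ≃ₗᵢ[ℂ] H := fun k => ρ (intVec k) with hr
  choose τ hτb using fun s : ι → ℝ => b.exists_synthesis (v := fun m => ρ (intVec m) (ρ s g)) hsum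
    fun i j => by
      rw [projRep_comm hρ (intVec i), projRep_comm hρ (intVec j), inner_smul_left,
        inner_smul_right, LinearIsometryEquiv.inner_map_map, norm_mul, norm_mul, RCLike.norm_conj,
        norm_fourierChar, norm_fourierChar, one_mul, one_mul, norm_inner_projRep hρ,
        sub_eq_add_neg j, intVec_add, intVec_neg, sub_eq_add_neg]
  have hτ0 : ∀ s, τ s (b 0) = ρ s g := fun s => by
    rw [hτb, intVec_zero, projRep_zero hρ]
  have hτ : ∀ s, τ s ∈ intertwiners l r := fun s =>
    (mem_intertwiners_iff_apply_basis hρ hl).2 fun m => by rw [hτb, hτ0]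
  have hnd' : ∀ y : H, (∀ S ∈ intertwiners l r, adjoint S y = 0) → y = 0 := fun y hy => by
    refine eq_zero_of_ae_inner_projRep_eq_zero hρ hg hmeas hM (.of_forall fun s m => ?_)
    have h1 : adjoint (τ s) (ρ (intVec m) y) = 0 := by
      have := mem_intertwiners.1 (intertwiners_adjoint (hτ s)) m y
      rw [hy _ (hτ s), map_zero] at this
      exact this
    rw [← hτ0, ← adjoint_inner_left, h1, inner_zero_left]
  obtain ⟨T, hT, hT1, hext⟩ := exists_extreme_intertwiner l r
  set P := (defectKernel' l r T)ᗮ.starProjection with hP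
  set Q := (defectKernel l r T)ᗮ.starProjection with hQ
  have hTT := intertwiners_comp hT (intertwiners_adjoint hT)
  have hTT' := intertwiners_comp (intertwiners_adjoint hT) hT
  obtain ⟨hPm, hPI⟩ := setLIntegral_enorm_sq_starProjection hρ hl hV hsum hnd hT hτ hτ0
  have hPT : P ∘L T ∈ intertwiners l r := fun k x => by
    have hQl : ∀ x, Q (l k x) = l k (Q x) := starProjection_defectKernel_commute hT (k := k)
      fun j => ⟨_, Circle.coe_ne_zero _, projRep_comm hρ _ _, twistedTranslation_comm hl k j⟩
    simp only [coe_comp, Function.comp_apply, hP, starProjection_defectKernel_apply hT]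
    rw [← hQ, hQl, hT]
  have hadj : ∀ y, adjoint (P ∘L T) y = adjoint T (P y) := fun y => by
    refine ext_inner_right ℂ fun x => ?_
    rw [adjoint_inner_left, adjoint_inner_left]
    exact (Submodule.inner_starProjection_left_eq_right _ _ _).symm
  have hTI := setLIntegral_enorm_sq_adjoint_apply hρ hmeas hM hl hPT
  have hp : ‖P (T (b 0))‖ₑ = ‖Q (b 0)‖ₑ := by
    have h1 : ‖T (Q (b 0))‖ ^ 2 = ‖Q (b 0)‖ ^ 2 := by
      rw [← inner_self_eq_norm_sq (𝕜 := ℂ), ← adjoint_inner_right,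
        adjoint_apply_starProjection_defectKernel hT hT1 hext, inner_self_eq_norm_sq]
    rw [hP, starProjection_defectKernel_apply hT, ← ofReal_norm, ← ofReal_norm,
      (sq_eq_sq₀ (norm_nonneg _) (norm_nonneg _)).1 h1]
  have hae : ∀ᵐ s ∂volume.restrict (unitCube ι), T (adjoint T (ρ s g)) = ρ s g := by
    have hle : ∀ s, ‖adjoint (P ∘L T) (ρ s g)‖ₑ ^ 2 ≤ ‖P (ρ s g)‖ₑ ^ 2 := fun s => by
      rw [hadj, ← ofReal_norm, ← ofReal_norm]
      gcongr
      exact adjoint_apply_le_of_norm_le_one hT1 _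
    have hfin : ∫⁻ s in unitCube ι, ‖adjoint (P ∘L T) (ρ s g)‖ₑ ^ 2 ≠ ∞ := by
      rw [hTI]
      exact ENNReal.mul_ne_top (by simp) (by simp)
    have := ae_eq_of_ae_le_of_lintegral_le (.of_forall hle) hfin hPm.aemeasurable (by
      rw [hPI, hTI]
      simp only [coe_comp, Function.comp_apply]
      rw [hp])
    filter_upwards [this] with s hs
    rw [hadj] at hs
    have h1 : T (adjoint T (P (ρ s g))) = P (ρ s g) := by
      refine apply_adjoint_apply_eq_self hT1 (le_of_eq ?_)
      have h2 : ‖adjoint T (P (ρ s g))‖ₑ = ‖P (ρ s g)‖ₑ := by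
        exact (ENNReal.pow_right_strictMono two_ne_zero).injective hs
      rw [← toReal_enorm, ← toReal_enorm, h2]
    have h2 := apply_adjoint_sub_starProjection hT hnd' (ρ s g)
    rw [← hP, map_sub, map_sub, h1] at h2
    exact sub_left_injective h2
  have hTTid : ∀ y, T (adjoint T y) = y := fun y => by
    rw [← sub_eq_zero]
    refine eq_zero_of_ae_inner_projRep_eq_zero hρ hg hmeas hM ?_
    filter_upwards [hae] with s hs m
    have h1 := mem_intertwiners.1 hTT m y
    simp only [coe_comp, Function.comp_apply, hr] at h1
    rw [map_sub, ← h1, inner_sub_left, ← adjoint_inner_right, adjoint_inner_left, hs, sub_self]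
  have hTn : ∀ y, ‖adjoint T y‖ = ‖y‖ := fun y => by
    refine (sq_eq_sq₀ (norm_nonneg _) (norm_nonneg _)).1 ?_
    rw [← inner_self_eq_norm_sq (𝕜 := ℂ), adjoint_inner_right, hTTid, inner_self_eq_norm_sq]
  have hh : ‖T (b 0)‖ = 1 := by
    have h1 := setLIntegral_enorm_sq_adjoint_apply hρ hmeas hM hl hT
    simp_rw [← ofReal_norm, hTn, LinearIsometryEquiv.norm_map] at h1
    rw [lintegral_const, measure_univ, mul_one, ← ENNReal.ofReal_pow (norm_nonneg _),
      ← ENNReal.ofReal_pow (norm_nonneg _), ← ENNReal.ofReal_mul (by positivity),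
      ENNReal.ofReal_eq_ofReal_iff (by positivity) (by positivity)] at h1
    have h2 : ‖g‖ ^ 2 ≠ 0 := by simpa using hg
    have h3 : ‖T (b 0)‖ ^ 2 = 1 := (right_eq_mul₀ h2).1 h1
    exact (pow_eq_one_iff_of_nonneg (norm_nonneg _) two_ne_zero).1 h3
  have hb0 : adjoint T (T (b 0)) = b 0 := by
    have h1 : ‖adjoint T‖ ≤ 1 := by rwa [LinearIsometryEquiv.norm_map]
    have h2 := apply_adjoint_apply_eq_self h1 (y := b 0)
      (by rw [adjoint_adjoint, hh, b.orthonormal.1])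
    rwa [adjoint_adjoint] at h2
  have hlb : ∀ m, l m (b 0) = b m := fun m => by rw [hl]; simp [intVec_zero]
  have hbm : ∀ m, adjoint T (T (b m)) = b m := fun m => by
    have h1 := mem_intertwiners.1 hTT' m (b 0)
    simp only [coe_comp, Function.comp_apply, hb0] at h1
    rw [← hlb, h1]
  have hTb : ∀ m, T (b m) = ρ (intVec m) (T (b 0)) :=
    (mem_intertwiners_iff_apply_basis hρ hl).1 hT
  refine ⟨T (b 0), ?_, ?_⟩
  · rw [orthonormal_iff_ite]
    intro i j
    rw [← hTb, ← hTb, ← adjoint_inner_right, hbm]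
    exact orthonormal_iff_ite.1 b.orthonormal i j
  · rw [Submodule.topologicalClosure_eq_top_iff, Submodule.eq_bot_iff]
    intro y hy
    rw [← hTTid y]
    have h1 : adjoint T y = 0 := by
      have h2 : ‖adjoint T y‖ₑ ^ 2 = 0 := by
        rw [enorm_sq_adjoint_apply_of_mem_intertwiners hρ hl hT, ENNReal.tsum_eq_zero]
        intro m
        have h3 := (Submodule.mem_orthogonal _ _).1 hy (ρ (intVec m) (T (b 0)))
          (Submodule.subset_span ⟨m, rfl⟩)
        rw [h3]
        simp
      simpa using h2
    rw [h1, map_zero]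

end ExistenceOfBasis

section Plancherel

open FourierTransform
open scoped ContDiff SchwartzMap InnerProductSpace ENNReal

/-- Plancherel's theorem for functions that are both integrable and square integrable. -/
theorem lintegral_enorm_sq_fourier {V : Type*} [NormedAddCommGroup V] [InnerProductSpace ℝ V]
    [FiniteDimensional ℝ V] [MeasurableSpace V] [BorelSpace V] {F : V → ℂ} (h1 : Integrable F)
    (h2 : MemLp F 2) : ∫⁻ w, ‖𝓕 F w‖ₑ ^ 2 = ∫⁻ x, ‖F x‖ₑ ^ 2 := by
  set f : Lp ℂ 2 (volume : Measure V) := h2.toLp F with hf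
  have hcont : Continuous (𝓕 F) := VectorFourier.fourierIntegral_continuous
    Real.continuous_fourierChar (by exact continuous_inner) h1
  have hae : ∀ᵐ x, (𝓕 f : Lp ℂ 2 (volume : Measure V)) x = 𝓕 F x := by
    refine ae_eq_of_integral_contDiff_smul_eq ((Lp.memLp _).locallyIntegrable (by norm_num))
      hcont.locallyIntegrable fun u hu huc => ?_
    have hu1 : HasCompactSupport (Complex.ofRealCLM ∘ u) := huc.comp_left rfl
    have hu2 : ContDiff ℝ ∞ (Complex.ofRealCLM ∘ u) := by fun_prop
    set U : 𝓢(V, ℂ) := hu1.toSchwartzMap hu2 with hU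
    have hUx : ∀ x, U x = (u x : ℂ) := fun x => rfl
    have e1 := congrArg (fun T => T U) (Lp.fourier_toTemperedDistribution_eq f)
    simp only [TemperedDistribution.fourier_apply, Lp.toTemperedDistribution_apply] at e1
    have e2 : ∫ x, (𝓕 U) x • f x = ∫ x, (𝓕 U) x • F x := by
      refine integral_congr_ae ?_
      filter_upwards [h2.coeFn_toLp] with x hx
      rw [hf, hx]
    have e3 : ∫ x, (𝓕 U) x • F x = ∫ x, U x • 𝓕 F x := by
      have := VectorFourier.integral_fourierIntegral_smul_eq_flip (μ := (volume : Measure V))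
        (ν := (volume : Measure V)) (L := innerₗ V) (f := U) (g := F)
        Real.continuous_fourierChar (by exact continuous_inner) U.integrable h1
      rw [flip_innerₗ] at this
      exact this
    rw [e2, e3] at e1
    simp only [hUx] at e1
    simpa using e1.symm
  have n1 : eLpNorm (𝓕 F) 2 volume = eLpNorm F 2 volume := by
    rw [← eLpNorm_congr_ae hae, ← Lp.enorm_def, ← ofReal_norm, Lp.norm_fourier_eq, ofReal_norm,
      Lp.enorm_def]
    exact eLpNorm_congr_ae h2.coeFn_toLp
  have key : ∀ G : V → ℂ, eLpNorm G 2 volume ^ 2 = ∫⁻ x, ‖G x‖ₑ ^ 2 := fun G => by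
    have := eLpNorm_nnreal_pow_eq_lintegral (μ := (volume : Measure V)) (f := G) (p := 2)
      (by norm_num)
    simpa using this
  rw [← key, ← key, n1]

theorem lintegral_enorm_sq_integral_fourierChar {ι : Type*} [Fintype ι] {F : (ι → ℝ) → ℂ}
    (h1 : Integrable F) (h2 : MemLp F 2) :
    ∫⁻ w : ι → ℝ, ‖∫ x, (𝐞 (∑ i, w i * x i) : ℂ) * F x‖ₑ ^ 2 = ∫⁻ x, ‖F x‖ₑ ^ 2 := by
  have hv := EuclideanSpace.volume_preserving_symm_measurableEquiv_toLp ι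
  set e := (MeasurableEquiv.toLp 2 (ι → ℝ)).symm with he
  have hF1 : Integrable (F ∘ e) := (hv.integrable_comp_emb e.measurableEmbedding).2 h1
  have hF2 : MemLp (F ∘ e) 2 := h2.comp_measurePreserving hv
  have h := lintegral_enorm_sq_fourier hF1 hF2
  have hr : ∫⁻ x, ‖(F ∘ e) x‖ₑ ^ 2 = ∫⁻ x, ‖F x‖ₑ ^ 2 :=
    hv.lintegral_comp_emb e.measurableEmbedding (fun x => ‖F x‖ₑ ^ 2)
  rw [← hr, ← h, ← lintegral_neg_eq_self, ← hv.lintegral_comp_emb e.measurableEmbedding]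
  refine lintegral_congr fun w => ?_
  rw [Real.fourier_eq, ← hv.integral_comp e.measurableEmbedding]
  congr 3
  ext x
  rw [Circle.smul_def, smul_eq_mul]
  congr 3
  simp [he, PiLp.inner_apply, Finset.sum_neg_distrib]

end Plancherel

noncomputable def timeFreqShift {d : ℕ} (t ω : Fin d → ℝ) (g : (Fin d → ℝ) → ℂ) :
    (Fin d → ℝ) → ℂ :=
  fun x => Complex.exp (2 * Real.pi * Complex.I * ((∑ i, ω i * x i : ℝ) : ℂ)) * g (x - t)

section TimeFrequencyShift

open scoped ENNReal FourierTransform InnerProductSpace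

variable {d : ℕ}

theorem timeFreqShift_apply (t ω : Fin d → ℝ) (g : (Fin d → ℝ) → ℂ) (x : Fin d → ℝ) :
    timeFreqShift t ω g x = (𝐞 (∑ i, ω i * x i) : ℂ) * g (x - t) := by
  rw [timeFreqShift, Real.fourierChar_apply]
  push_cast
  ring_nf

theorem measurePreserving_sub_const (t : Fin d → ℝ) :
    MeasurePreserving (fun x : Fin d → ℝ => x - t) :=
  measurePreserving_sub_right volume t

theorem timeFreqShift_congr_ae (t ω : Fin d → ℝ) {g g' : (Fin d → ℝ) → ℂ} (h : g =ᵐ[volume] g') :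
    timeFreqShift t ω g =ᵐ[volume] timeFreqShift t ω g' := by
  filter_upwards [(measurePreserving_sub_const t).quasiMeasurePreserving.ae_eq_comp h] with x hx
  simp only [Function.comp_apply] at hx
  rw [timeFreqShift, timeFreqShift, hx]

theorem memLp_timeFreqShift (t ω : Fin d → ℝ) {g : (Fin d → ℝ) → ℂ} (hg : MemLp g 2) :
    MemLp (timeFreqShift t ω g) 2 := by
  have h1 := hg.comp_measurePreserving (measurePreserving_sub_const t)
  refine h1.of_le (.mul (Continuous.aestronglyMeasurable (by fun_prop)) h1.1) (.of_forall fun x => le_of_eq ?_)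
  rw [timeFreqShift_apply, norm_mul, Circle.norm_coe, one_mul]
  rfl

theorem eLpNorm_timeFreqShift (t ω : Fin d → ℝ) {g : (Fin d → ℝ) → ℂ} (hg : MemLp g 2) :
    eLpNorm (timeFreqShift t ω g) 2 volume = eLpNorm g 2 volume := by
  rw [← eLpNorm_comp_measurePreserving hg.1 (measurePreserving_sub_const t)]
  refine eLpNorm_congr_norm_ae (.of_forall fun x => ?_)
  rw [timeFreqShift_apply, norm_mul, Circle.norm_coe, one_mul]
  rfl

theorem timeFreqShift_timeFreqShift (t ω s η : Fin d → ℝ) (g : (Fin d → ℝ) → ℂ) (x : Fin d → ℝ) :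
    timeFreqShift t ω (timeFreqShift s η g) x =
      (𝐞 (-∑ i, η i * t i) : ℂ) * timeFreqShift (t + s) (ω + η) g x := by
  simp only [timeFreqShift_apply]
  rw [← mul_assoc, ← mul_assoc, ← Circle.coe_mul, ← Circle.coe_mul, ← AddChar.map_add_eq_mul,
    ← AddChar.map_add_eq_mul, sub_sub]
  congr 3
  simp only [Pi.sub_apply, Pi.add_apply, ← Finset.sum_add_distrib, ← Finset.sum_neg_distrib]
  congr 1
  ext i
  ring

theorem timeFreqShift_zero (g : (Fin d → ℝ) → ℂ) : timeFreqShift 0 0 g = g := by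
  ext x
  simp [timeFreqShift_apply]

/-- The time-frequency shift as a linear isometry of `L²`. -/
noncomputable def tfIsometry (t ω : Fin d → ℝ) :
    Lp ℂ 2 (volume : Measure (Fin d → ℝ)) →ₗᵢ[ℂ] Lp ℂ 2 (volume : Measure (Fin d → ℝ)) where
  toFun g := (memLp_timeFreqShift t ω (Lp.memLp g)).toLp (timeFreqShift t ω g)
  map_add' g h := by
    rw [← MemLp.toLp_add]
    refine MemLp.toLp_congr _ _ ?_
    filter_upwards [timeFreqShift_congr_ae t ω (Lp.coeFn_add g h)] with x hx
    rw [hx]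
    simp [timeFreqShift, mul_add]
  map_smul' c g := by
    rw [RingHom.id_apply, ← MemLp.toLp_const_smul]
    refine MemLp.toLp_congr _ _ ?_
    filter_upwards [timeFreqShift_congr_ae t ω (Lp.coeFn_smul c g)] with x hx
    rw [hx]
    simp [timeFreqShift]
    ring
  norm_map' g := by
    change ‖(memLp_timeFreqShift t ω (Lp.memLp g)).toLp (timeFreqShift t ω g)‖ = ‖g‖
    rw [Lp.norm_toLp, eLpNorm_timeFreqShift t ω (Lp.memLp g), Lp.norm_def]

theorem coeFn_tfIsometry (t ω : Fin d → ℝ) (g : Lp ℂ 2 (volume : Measure (Fin d → ℝ))) :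
    tfIsometry t ω g =ᵐ[volume] timeFreqShift t ω g :=
  MemLp.coeFn_toLp (memLp_timeFreqShift t ω (Lp.memLp g))

theorem tfIsometry_tfIsometry (t ω s η : Fin d → ℝ)
    (g : Lp ℂ 2 (volume : Measure (Fin d → ℝ))) :
    tfIsometry t ω (tfIsometry s η g) =
      (𝐞 (-∑ i, η i * t i) : ℂ) • tfIsometry (t + s) (ω + η) g := by
  refine Lp.ext ?_
  filter_upwards [coeFn_tfIsometry t ω (tfIsometry s η g),
    timeFreqShift_congr_ae t ω (coeFn_tfIsometry s η g), coeFn_tfIsometry (t + s) (ω + η) g,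
    Lp.coeFn_smul (𝐞 (-∑ i, η i * t i) : ℂ) (tfIsometry (t + s) (ω + η) g)] with x h1 h2 h3 h4
  rw [h1, h2, h4, timeFreqShift_timeFreqShift, Pi.smul_apply, smul_eq_mul, h3]

theorem tfIsometry_zero (g : Lp ℂ 2 (volume : Measure (Fin d → ℝ))) : tfIsometry 0 0 g = g := by
  refine Lp.ext ?_
  filter_upwards [coeFn_tfIsometry 0 0 g] with x h
  rw [h, timeFreqShift_zero]

/-- The time-frequency shift as a unitary of `L²`. -/
noncomputable def tfUnitary (t ω : Fin d → ℝ) :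
    Lp ℂ 2 (volume : Measure (Fin d → ℝ)) ≃ₗᵢ[ℂ] Lp ℂ 2 (volume : Measure (Fin d → ℝ)) :=
  LinearIsometryEquiv.ofSurjective (tfIsometry t ω) fun g => by
    refine ⟨(𝐞 (-∑ i, (-ω) i * t i) : ℂ)⁻¹ • tfIsometry (-t) (-ω) g, ?_⟩
    rw [map_smul, tfIsometry_tfIsometry, add_neg_cancel, add_neg_cancel, smul_smul,
      inv_mul_cancel₀ (Circle.coe_ne_zero _), one_smul, tfIsometry_zero]

theorem coeFn_tfUnitary (t ω : Fin d → ℝ) (g : Lp ℂ 2 (volume : Measure (Fin d → ℝ))) :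
    tfUnitary t ω g =ᵐ[volume] timeFreqShift t ω g :=
  coeFn_tfIsometry t ω g

theorem tfUnitary_tfUnitary (t ω s η : Fin d → ℝ)
    (g : Lp ℂ 2 (volume : Measure (Fin d → ℝ))) :
    tfUnitary t ω (tfUnitary s η g) =
      (𝐞 (-∑ i, η i * t i) : ℂ) • tfUnitary (t + s) (ω + η) g :=
  tfIsometry_tfIsometry t ω s η g

theorem inner_tfUnitary (t ω : Fin d → ℝ) (f g : Lp ℂ 2 (volume : Measure (Fin d → ℝ)))
    {g₀ : (Fin d → ℝ) → ℂ} (hg : g =ᵐ[volume] g₀) :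
    ⟪f, tfUnitary t ω g⟫_ℂ =
      ∫ x, (𝐞 (∑ i, ω i * x i) : ℂ) * ((starRingEnd ℂ) (f x) * g₀ (x - t)) := by
  rw [L2.inner_def]
  refine integral_congr_ae ?_
  filter_upwards [coeFn_tfUnitary t ω g, timeFreqShift_congr_ae t ω hg] with x h1 h2
  rw [h1, h2, timeFreqShift_apply, RCLike.inner_apply]
  ring

end TimeFrequencyShift

section Moyal

open scoped ENNReal FourierTransform InnerProductSpace

variable {d : ℕ}

theorem eLpNorm_two_sq {α : Type*} [MeasurableSpace α] {μ : Measure α} (G : α → ℂ) :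
    eLpNorm G 2 μ ^ 2 = ∫⁻ x, ‖G x‖ₑ ^ 2 ∂μ := by
  simpa using eLpNorm_nnreal_pow_eq_lintegral (μ := μ) (f := G) (p := 2) (by norm_num)

theorem measurable_integral_fourierChar_mul {f g : (Fin d → ℝ) → ℂ} (hf : Measurable f)
    (hg : Measurable g) :
    Measurable fun p : (Fin d → ℝ) × (Fin d → ℝ) =>
      ∫ x, (𝐞 (∑ i, p.2 i * x i) : ℂ) * ((starRingEnd ℂ) (f x) * g (x - p.1)) := by
  have hc : Measurable fun q : ((Fin d → ℝ) × (Fin d → ℝ)) × (Fin d → ℝ) =>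
      (𝐞 (∑ i, q.1.2 i * q.2 i) : ℂ) := by
    have : Continuous fun q : ((Fin d → ℝ) × (Fin d → ℝ)) × (Fin d → ℝ) =>
      ∑ i, q.1.2 i * q.2 i := by fun_prop
    exact (continuous_subtype_val.comp (Real.continuous_fourierChar.comp this)).measurable
  have hm : Measurable fun q : ((Fin d → ℝ) × (Fin d → ℝ)) × (Fin d → ℝ) =>
      (𝐞 (∑ i, q.1.2 i * q.2 i) : ℂ) * ((starRingEnd ℂ) (f q.2) * g (q.2 - q.1.1)) :=
    hc.mul ((Complex.continuous_conj.measurable.comp (hf.comp measurable_snd)).mul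
      (hg.comp (measurable_snd.sub (measurable_fst.comp measurable_fst))))
  exact hm.stronglyMeasurable.integral_prod_right'.measurable

/-- Moyal's identity for a bounded window. -/
theorem lintegral_lintegral_enorm_sq_eq {f g : (Fin d → ℝ) → ℂ} (hf : Measurable f)
    (hf2 : MemLp f 2) (hg : Measurable g) (hg2 : MemLp g 2) {M : ℝ} (hM : ∀ x, ‖g x‖ ≤ M) :
    ∫⁻ t : Fin d → ℝ, ∫⁻ w : Fin d → ℝ,
      ‖∫ x, (𝐞 (∑ i, w i * x i) : ℂ) * ((starRingEnd ℂ) (f x) * g (x - t))‖ₑ ^ 2 =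
      eLpNorm f 2 volume ^ 2 * eLpNorm g 2 volume ^ 2 := by
  have h1 : ∀ t, ∫⁻ w : Fin d → ℝ,
      ‖∫ x, (𝐞 (∑ i, w i * x i) : ℂ) * ((starRingEnd ℂ) (f x) * g (x - t))‖ₑ ^ 2 =
      ∫⁻ x, ‖f x‖ₑ ^ 2 * ‖g (x - t)‖ₑ ^ 2 := fun t => by
    have hgt : MemLp (fun x => g (x - t)) 2 :=
      hg2.comp_measurePreserving (measurePreserving_sub_const t)
    have hfc : MemLp (fun x => (starRingEnd ℂ) (f x)) 2 := hf2.star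
    have hI : Integrable (fun x => (starRingEnd ℂ) (f x) * g (x - t)) := hfc.integrable_mul hgt
    have h2 : MemLp (fun x => (starRingEnd ℂ) (f x) * g (x - t)) 2 := by
      refine hfc.of_le_mul (c := M) hI.1 (.of_forall fun x => ?_)
      rw [norm_mul, mul_comm]
      exact mul_le_mul_of_nonneg_right (hM _) (norm_nonneg _)
    rw [lintegral_enorm_sq_integral_fourierChar hI h2]
    refine lintegral_congr fun x => ?_
    rw [enorm_mul, mul_pow, ← ofReal_norm, RCLike.norm_conj, ofReal_norm]
  simp_rw [h1]
  rw [lintegral_lintegral_swap]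
  · have h2 : ∀ x, ∫⁻ t, ‖f x‖ₑ ^ 2 * ‖g (x - t)‖ₑ ^ 2 =
        ‖f x‖ₑ ^ 2 * eLpNorm g 2 volume ^ 2 := fun x => by
      rw [lintegral_const_mul _ (by fun_prop),
        lintegral_sub_left_eq_self (fun t => ‖g t‖ₑ ^ 2) x, eLpNorm_two_sq]
    simp_rw [h2]
    rw [lintegral_mul_const _ (by fun_prop), eLpNorm_two_sq f]
  · have : Measurable (Function.uncurry fun (t x : Fin d → ℝ) => ‖f x‖ₑ ^ 2 * ‖g (x - t)‖ₑ ^ 2) := by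
      simp only [Function.uncurry_def]
      fun_prop
    exact this.aemeasurable

variable {f g : Lp ℂ 2 (volume : Measure (Fin d → ℝ))} {g₀ : (Fin d → ℝ) → ℂ}

theorem measurable_inner_tfUnitary (hg₀ : Measurable g₀) (hg : g =ᵐ[volume] g₀) :
    Measurable fun p : (Fin d → ℝ) × (Fin d → ℝ) => ⟪f, tfUnitary p.1 p.2 g⟫_ℂ := by
  simp_rw [inner_tfUnitary _ _ f g hg]
  exact measurable_integral_fourierChar_mul (Lp.stronglyMeasurable f).measurable hg₀

theorem lintegral_enorm_sq_inner_tfUnitary (hg₀ : Measurable g₀) (hg : g =ᵐ[volume] g₀) {M : ℝ}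
    (hM : ∀ x, ‖g₀ x‖ ≤ M) :
    ∫⁻ p : (Fin d → ℝ) × (Fin d → ℝ), ‖⟪f, tfUnitary p.1 p.2 g⟫_ℂ‖ₑ ^ 2 =
      ‖f‖ₑ ^ 2 * ‖g‖ₑ ^ 2 := by
  rw [Measure.volume_eq_prod, lintegral_prod _
    ((measurable_inner_tfUnitary hg₀ hg).enorm.pow_const 2).aemeasurable]
  simp_rw [inner_tfUnitary _ _ f g hg]
  rw [lintegral_lintegral_enorm_sq_eq (Lp.stronglyMeasurable f).measurable (Lp.memLp f) hg₀
    ((memLp_congr_ae hg).1 (Lp.memLp g)) hM, ← eLpNorm_congr_ae hg, Lp.enorm_def, Lp.enorm_def]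

theorem measurable_mulVec_inl_inr (C : Matrix (Fin d ⊕ Fin d) (Fin d ⊕ Fin d) ℝ) :
    Measurable fun s : Fin d ⊕ Fin d → ℝ => (((fun i => C.mulVec s (Sum.inl i)),
      fun i => C.mulVec s (Sum.inr i)) : (Fin d → ℝ) × (Fin d → ℝ)) := by
  have hL : Measurable fun s : Fin d ⊕ Fin d → ℝ => C.mulVec s :=
    (Matrix.toLin' C).continuous_of_finiteDimensional.measurable
  exact (measurable_pi_lambda _ fun i => (measurable_pi_apply _).comp hL).prodMk
    (measurable_pi_lambda _ fun i => (measurable_pi_apply _).comp hL)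

theorem lintegral_comp_mulVec_inl_inr {C : Matrix (Fin d ⊕ Fin d) (Fin d ⊕ Fin d) ℝ}
    (hC : C.det ≠ 0) {F : (Fin d → ℝ) × (Fin d → ℝ) → ℝ≥0∞} (hF : Measurable F) :
    ∫⁻ s : Fin d ⊕ Fin d → ℝ, F ((fun i => C.mulVec s (Sum.inl i)),
      fun i => C.mulVec s (Sum.inr i)) = ENNReal.ofReal |C.det⁻¹| * ∫⁻ p, F p := by
  have hsplit : Measurable fun s : Fin d ⊕ Fin d → ℝ =>
      (((fun i => s (Sum.inl i)), fun i => s (Sum.inr i)) : (Fin d → ℝ) × (Fin d → ℝ)) := by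
    fun_prop
  have he : MeasurePreserving fun s : Fin d ⊕ Fin d → ℝ =>
      (((fun i => s (Sum.inl i)), fun i => s (Sum.inr i)) : (Fin d → ℝ) × (Fin d → ℝ)) :=
    volume_measurePreserving_sumPiEquivProdPi (fun _ : Fin d ⊕ Fin d => ℝ)
  have hL : Measurable fun s : Fin d ⊕ Fin d → ℝ => C.mulVec s :=
    (Matrix.toLin' C).continuous_of_finiteDimensional.measurable
  have hmap : Measure.map (fun s : Fin d ⊕ Fin d → ℝ => C.mulVec s) volume =
    ENNReal.ofReal |C.det⁻¹| • volume := Real.map_matrix_volume_pi_eq_smul_volume_pi hC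
  have h1 := lintegral_map (μ := (volume : Measure (Fin d ⊕ Fin d → ℝ))) (hF.comp hsplit) hL
  rw [hmap, lintegral_smul_measure] at h1
  refine h1.symm.trans ?_
  rw [smul_eq_mul, ← he.lintegral_comp hF]
  rfl

/-- Moyal's identity in lattice coordinates. -/
theorem lintegral_enorm_sq_inner_tfUnitary_mulVec (hg₀ : Measurable g₀) (hg : g =ᵐ[volume] g₀)
    {M : ℝ} (hM : ∀ x, ‖g₀ x‖ ≤ M) {C : Matrix (Fin d ⊕ Fin d) (Fin d ⊕ Fin d) ℝ}
    (hC : C.det ≠ 0) :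
    ∫⁻ s : Fin d ⊕ Fin d → ℝ, ‖⟪f, tfUnitary (fun i => C.mulVec s (Sum.inl i))
        (fun i => C.mulVec s (Sum.inr i)) g⟫_ℂ‖ₑ ^ 2 =
      ENNReal.ofReal |C.det⁻¹| * ‖f‖ₑ ^ 2 * ‖g‖ₑ ^ 2 := by
  rw [mul_assoc, ← lintegral_enorm_sq_inner_tfUnitary hg₀ hg hM]
  exact lintegral_comp_mulVec_inl_inr hC
    ((measurable_inner_tfUnitary (f := f) hg₀ hg).enorm.pow_const 2)

theorem measurable_inner_tfUnitary_mulVec (hg₀ : Measurable g₀) (hg : g =ᵐ[volume] g₀)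
    (C : Matrix (Fin d ⊕ Fin d) (Fin d ⊕ Fin d) ℝ) :
    Measurable fun s : Fin d ⊕ Fin d → ℝ => ⟪f, tfUnitary (fun i => C.mulVec s (Sum.inl i))
      (fun i => C.mulVec s (Sum.inr i)) g⟫_ℂ := by
  have h := Measurable.comp (g := fun p : (Fin d → ℝ) × (Fin d → ℝ) => ⟪f, tfUnitary p.1 p.2 g⟫_ℂ)
    (measurable_inner_tfUnitary (f := f) hg₀ hg) (measurable_mulVec_inl_inr C)
  simp only [Function.comp_def] at h
  exact h

end Moyal

section GaussianSums

variable {ι : Type*} [Fintype ι]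

theorem summable_prod_apply {κ : Type*} {f : κ → ℝ} (hf : Summable f)
    (h0 : ∀ k, 0 ≤ f k) : Summable fun m : ι → κ => ∏ i, f (m i) := by
  classical
  refine summable_of_sum_le (c := ∏ _i : ι, ∑' k, f k)
    (fun m => Finset.prod_nonneg fun i _ => h0 _) fun s => ?_
  let T : ι → Finset κ := fun i => s.image fun m => m i
  have h1 : ∑ m ∈ s, ∏ i, f (m i) ≤ ∑ m ∈ Fintype.piFinset T, ∏ i, f (m i) :=
    Finset.sum_le_sum_of_subset_of_nonneg
      (fun m hm => Fintype.mem_piFinset.2 fun i => Finset.mem_image_of_mem _ hm)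
      fun m _ _ => Finset.prod_nonneg fun i _ => h0 _
  have h2 : ∑ m ∈ Fintype.piFinset T, ∏ i, f (m i) = ∏ i, ∑ k ∈ T i, f k :=
    (Finset.prod_univ_sum T fun _ k => f k).symm
  refine h1.trans (h2.le.trans ?_)
  exact Finset.prod_le_prod (fun i _ => Finset.sum_nonneg fun k _ => h0 k)
    fun i _ => hf.sum_le_tsum (T i) fun k _ => h0 k

theorem summable_exp_neg_mul_int_sq {a : ℝ} (ha : 0 < a) :
    Summable fun n : ℤ => Real.exp (-a * (n : ℝ) ^ 2) := by
  have h : Summable fun n : ℕ => Real.exp (-a * (n : ℝ) ^ 2) := by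
    refine Summable.of_nonneg_of_le (fun n => (Real.exp_pos _).le) (fun n => ?_)
      (summable_geometric_of_lt_one (Real.exp_pos (-a)).le (Real.exp_lt_one_iff.2 (neg_lt_zero.2 ha)))
    rw [← Real.exp_nat_mul, Real.exp_le_exp]
    have : (n : ℝ) ≤ (n : ℝ) ^ 2 := by exact_mod_cast Nat.le_self_pow two_ne_zero n
    nlinarith
  refine Summable.of_nat_of_neg (by simpa using h) (by simpa using h)

theorem exists_pos_mul_sum_sq_le_sum_sq_mulVec [DecidableEq ι] {C : Matrix ι ι ℝ}
    (hC : IsUnit C.det) :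
    ∃ c : ℝ, 0 < c ∧ ∀ v : ι → ℝ, c * ∑ i, v i ^ 2 ≤ ∑ i, C.mulVec v i ^ 2 := by
  obtain ⟨K, hK, hanti⟩ := (Matrix.toLin' C).exists_antilipschitzWith
    (LinearMap.ker_eq_bot.2 (Matrix.mulVec_injective_of_isUnit ((Matrix.isUnit_iff_isUnit_det C).2 hC)))
  have hle : ∀ v : ι → ℝ, ‖v‖ ≤ K * ‖C.mulVec v‖ := fun v => by
    simpa using hanti.le_mul_dist v 0
  have hKr : (0 : ℝ) < K := hK
  have hsup : ∀ w : ι → ℝ, ‖w‖ ^ 2 ≤ ∑ i, w i ^ 2 := fun w => by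
    have hs : 0 ≤ ∑ i, w i ^ 2 := Finset.sum_nonneg fun i _ => sq_nonneg _
    rw [← Real.le_sqrt (norm_nonneg _) hs, pi_norm_le_iff_of_nonneg (Real.sqrt_nonneg _)]
    intro i
    refine Real.le_sqrt_of_sq_le ?_
    rw [Real.norm_eq_abs, sq_abs]
    exact Finset.single_le_sum (f := fun i => w i ^ 2) (fun i _ => sq_nonneg _) (Finset.mem_univ i)
  have hn : (0 : ℝ) < Fintype.card ι + 1 := by positivity
  refine ⟨((Fintype.card ι + 1) * K ^ 2)⁻¹, by positivity, fun v => ?_⟩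
  rw [inv_mul_le_iff₀ (by positivity)]
  calc ∑ i, v i ^ 2 ≤ ∑ _i : ι, ‖v‖ ^ 2 := Finset.sum_le_sum fun i _ => by
        rw [← sq_abs, ← Real.norm_eq_abs]
        exact pow_le_pow_left₀ (norm_nonneg _) (norm_le_pi_norm v i) 2
    _ = Fintype.card ι * ‖v‖ ^ 2 := by simp
    _ ≤ (Fintype.card ι + 1) * (K * ‖C.mulVec v‖) ^ 2 :=
        mul_le_mul (by linarith) (pow_le_pow_left₀ (norm_nonneg _) (hle v) 2) (by positivity) hn.le
    _ = (Fintype.card ι + 1) * K ^ 2 * ‖C.mulVec v‖ ^ 2 := by ring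
    _ ≤ _ := mul_le_mul_of_nonneg_left (hsup _) (by positivity)

theorem summable_exp_neg_mul_sum_sq_mulVec [DecidableEq ι] {C : Matrix ι ι ℝ}
    (hC : IsUnit C.det) {a : ℝ} (ha : 0 < a) :
    Summable fun m : ι → ℤ => Real.exp (-a * ∑ i, C.mulVec (intVec m) i ^ 2) := by
  obtain ⟨c, hc, h⟩ := exists_pos_mul_sum_sq_le_sum_sq_mulVec hC
  refine Summable.of_nonneg_of_le (fun m => (Real.exp_pos _).le) (fun m => ?_)
    (summable_prod_apply (summable_exp_neg_mul_int_sq (mul_pos ha hc)) fun k => (Real.exp_pos _).le)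
  rw [← Real.exp_sum, Real.exp_le_exp, ← Finset.mul_sum]
  have := mul_le_mul_of_nonneg_left (h (intVec m)) ha.le
  simp only [intVec] at this ⊢
  linarith

end GaussianSums

section GaussianWindow

open scoped FourierTransform InnerProductSpace

variable {d : ℕ}

/-- The Gaussian `exp (-π |x|²)`. -/
noncomputable def gaussianWindow (x : Fin d → ℝ) : ℂ :=
  ∏ i, Complex.exp (-Real.pi * (x i : ℂ) ^ 2)

theorem norm_gaussianWindow (x : Fin d → ℝ) :
    ‖gaussianWindow x‖ = ∏ i, Real.exp (-Real.pi * x i ^ 2) := by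
  rw [gaussianWindow, norm_prod]
  refine Finset.prod_congr rfl fun i _ => ?_
  rw [Complex.norm_exp]
  norm_cast

theorem norm_gaussianWindow_le_one (x : Fin d → ℝ) : ‖gaussianWindow x‖ ≤ 1 := by
  rw [norm_gaussianWindow]
  refine Finset.prod_le_one (fun i _ => (Real.exp_pos _).le) fun i _ => ?_
  rw [Real.exp_le_one_iff]
  have := mul_nonneg Real.pi_pos.le (sq_nonneg (x i))
  linarith

theorem gaussianWindow_ne_zero (x : Fin d → ℝ) : gaussianWindow x ≠ 0 :=
  Finset.prod_ne_zero_iff.2 fun _ _ => Complex.exp_ne_zero _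

theorem measurable_gaussianWindow : Measurable (gaussianWindow (d := d)) := by
  unfold gaussianWindow
  fun_prop

theorem memLp_gaussianWindow : MemLp (gaussianWindow (d := d)) 2 := by
  rw [memLp_two_iff_integrable_sq_norm measurable_gaussianWindow.aestronglyMeasurable]
  have h : Integrable fun x : Fin d → ℝ => ∏ i, Real.exp (-(2 * Real.pi) * x i ^ 2) :=
    Integrable.fintype_prod (f := fun _ x => Real.exp (-(2 * Real.pi) * x ^ 2))
      fun _ => integrable_exp_neg_mul_sq (by positivity)
  refine h.congr (.of_forall fun x => ?_)
  simp only
  rw [norm_gaussianWindow, ← Finset.prod_pow]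
  refine Finset.prod_congr rfl fun i _ => ?_
  rw [← Real.exp_nat_mul]
  push_cast
  ring_nf

theorem norm_integral_gaussian_mul_gaussian (t ω : ℝ) :
    ‖∫ x : ℝ, (𝐞 (ω * x) : ℂ) * ((starRingEnd ℂ) (Complex.exp (-Real.pi * (x : ℂ) ^ 2)) *
      Complex.exp (-Real.pi * ((x - t : ℝ) : ℂ) ^ 2))‖ =
      ‖((Real.pi : ℂ) / (2 * Real.pi)) ^ (1 / 2 : ℂ)‖ *
        Real.exp (-(Real.pi / 2) * (t ^ 2 + ω ^ 2)) := by
  have h : ∀ x : ℝ, (𝐞 (ω * x) : ℂ) *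
      ((starRingEnd ℂ) (Complex.exp (-Real.pi * (x : ℂ) ^ 2)) *
      Complex.exp (-Real.pi * ((x - t : ℝ) : ℂ) ^ 2)) =
      Complex.exp ((-(2 * Real.pi)) * x ^ 2 + (2 * Real.pi * (t + ω * Complex.I)) * x +
        (-Real.pi * t ^ 2)) := fun x => by
    rw [Real.fourierChar_apply, ← Complex.exp_conj, ← Complex.exp_add, ← Complex.exp_add]
    simp only [map_mul, map_neg, map_pow, Complex.conj_ofReal]
    push_cast
    ring_nf
  simp_rw [h]
  have hpi : (Real.pi : ℂ) ≠ 0 := Complex.ofReal_ne_zero.2 Real.pi_ne_zero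
  rw [integral_cexp_quadratic (by simp [Real.pi_pos]), norm_mul, Complex.norm_exp, neg_neg]
  congr 2
  have : (-(Real.pi : ℂ) * t ^ 2 - (2 * Real.pi * (t + ω * Complex.I)) ^ 2 / (4 * -(2 * Real.pi))) =
      ((-(Real.pi / 2) * (t ^ 2 + ω ^ 2) : ℝ) : ℂ) + ((Real.pi * t * ω : ℝ) : ℂ) * Complex.I := by
    field_simp
    push_cast
    ring_nf
    simp only [Complex.I_sq]
    ring
  rw [this, Complex.add_re, Complex.ofReal_re, Complex.re_ofReal_mul, Complex.I_re, mul_zero,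
    add_zero]

variable {g : Lp ℂ 2 (volume : Measure (Fin d → ℝ))}

theorem norm_inner_tfUnitary_gaussianWindow (hg : g =ᵐ[volume] gaussianWindow)
    (t ω : Fin d → ℝ) :
    ‖⟪g, tfUnitary t ω g⟫_ℂ‖ = ‖((Real.pi : ℂ) / (2 * Real.pi)) ^ (1 / 2 : ℂ)‖ ^ d *
      Real.exp (-(Real.pi / 2) * (∑ i, t i ^ 2 + ∑ i, ω i ^ 2)) := by
  have h : ∫ x, (𝐞 (∑ i, ω i * x i) : ℂ) *
        ((starRingEnd ℂ) (g x) * gaussianWindow (x - t)) =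
      ∫ x : Fin d → ℝ, ∏ i, ((𝐞 (ω i * x i) : ℂ) *
        ((starRingEnd ℂ) (Complex.exp (-Real.pi * (x i : ℂ) ^ 2)) *
          Complex.exp (-Real.pi * ((x i - t i : ℝ) : ℂ) ^ 2))) := by
    refine integral_congr_ae ?_
    filter_upwards [hg] with x hx
    rw [hx, gaussianWindow, gaussianWindow, map_prod, Finset.prod_mul_distrib,
      Finset.prod_mul_distrib]
    congr 1
    simp only [Real.fourierChar_apply, ← Complex.exp_sum]
    congr 1
    push_cast
    rw [Finset.mul_sum, Finset.sum_mul]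
  rw [inner_tfUnitary t ω g g hg, h, integral_fintype_prod_volume_eq_prod
    (fun i (y : ℝ) => (𝐞 (ω i * y) : ℂ) *
        ((starRingEnd ℂ) (Complex.exp (-Real.pi * (y : ℂ) ^ 2)) *
          Complex.exp (-Real.pi * ((y - t i : ℝ) : ℂ) ^ 2))), norm_prod]
  simp_rw [norm_integral_gaussian_mul_gaussian]
  rw [Finset.prod_mul_distrib, Finset.prod_const, Finset.card_univ, Fintype.card_fin,
    ← Real.exp_sum, ← Finset.mul_sum, Finset.sum_add_distrib]

theorem summable_norm_inner_tfUnitary_gaussianWindow (hg : g =ᵐ[volume] gaussianWindow)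
    {C : Matrix (Fin d ⊕ Fin d) (Fin d ⊕ Fin d) ℝ} (hC : IsUnit C.det) :
    Summable fun m : Fin d ⊕ Fin d → ℤ =>
      ‖⟪g, tfUnitary (fun i => C.mulVec (intVec m) (Sum.inl i))
        (fun i => C.mulVec (intVec m) (Sum.inr i)) g⟫_ℂ‖ := by
  simp_rw [norm_inner_tfUnitary_gaussianWindow hg]
  refine Summable.mul_left _ ?_
  simpa only [Fintype.sum_sum_type] using
    summable_exp_neg_mul_sum_sq_mulVec hC (half_pos Real.pi_pos)

end GaussianWindow

section LatticeRepresentation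

open scoped FourierTransform InnerProductSpace ENNReal

variable {d : ℕ}

/-- The time-frequency shifts read in the coordinates given by the columns of `C`. -/
noncomputable def latticeRep (C : Matrix (Fin d ⊕ Fin d) (Fin d ⊕ Fin d) ℝ)
    (s : Fin d ⊕ Fin d → ℝ) :
    Lp ℂ 2 (volume : Measure (Fin d → ℝ)) ≃ₗᵢ[ℂ] Lp ℂ 2 (volume : Measure (Fin d → ℝ)) :=
  tfUnitary (fun i => C.mulVec s (Sum.inl i)) fun i => C.mulVec s (Sum.inr i)

/-- The bilinear form in the multiplier of `latticeRep`. -/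
noncomputable def latticeForm (C : Matrix (Fin d ⊕ Fin d) (Fin d ⊕ Fin d) ℝ) :
    (Fin d ⊕ Fin d → ℝ) →ₗ[ℝ] (Fin d ⊕ Fin d → ℝ) →ₗ[ℝ] ℝ :=
  LinearMap.mk₂ ℝ
    (fun s s' => -∑ i, C.mulVec s' (Sum.inr i) * C.mulVec s (Sum.inl i))
    (fun s s' u => by
      simp only [Matrix.mulVec_add, Pi.add_apply, mul_add, Finset.sum_add_distrib, neg_add])
    (fun c s s' => by
      simp only [Matrix.mulVec_smul, Pi.smul_apply, smul_eq_mul, mul_neg, Finset.mul_sum]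
      exact congrArg _ (Finset.sum_congr rfl fun i _ => by ring))
    (fun s s' u => by
      simp only [Matrix.mulVec_add, Pi.add_apply, add_mul, Finset.sum_add_distrib, neg_add])
    (fun c s s' => by
      simp only [Matrix.mulVec_smul, Pi.smul_apply, smul_eq_mul, mul_neg, Finset.mul_sum]
      exact congrArg _ (Finset.sum_congr rfl fun i _ => by ring))

variable (C : Matrix (Fin d ⊕ Fin d) (Fin d ⊕ Fin d) ℝ)

theorem latticeForm_apply (s s' : Fin d ⊕ Fin d → ℝ) :
    latticeForm C s s' = -∑ i, C.mulVec s' (Sum.inr i) * C.mulVec s (Sum.inl i) :=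
  rfl

theorem latticeRep_latticeRep (s t : Fin d ⊕ Fin d → ℝ)
    (x : Lp ℂ 2 (volume : Measure (Fin d → ℝ))) :
    latticeRep C s (latticeRep C t x) =
      (𝐞 (latticeForm C s t) : ℂ) • latticeRep C (s + t) x := by
  rw [latticeRep, latticeRep, latticeRep, tfUnitary_tfUnitary, latticeForm_apply,
    Matrix.mulVec_add]
  rfl

variable {C}

theorem latticeForm_nondegenerate (hC : IsUnit C.det) (m : Fin d ⊕ Fin d → ℤ)
    (h : ∀ s, latticeForm C s (intVec m) = latticeForm C (intVec m) s) : m = 0 := by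
  have hsurj : ∀ v, ∃ s, C.mulVec s = v := fun v =>
    Matrix.mulVec_surjective_iff_isUnit.2 ((Matrix.isUnit_iff_isUnit_det C).2 hC) v
  have hz : C.mulVec (intVec m) = 0 := by
    funext k
    cases k with
    | inl k =>
      obtain ⟨s, hs⟩ := hsurj (Pi.single (Sum.inr k) 1)
      have h1 := h s
      rw [latticeForm_apply, latticeForm_apply, hs] at h1
      simpa [Pi.single_apply] using h1
    | inr k =>
      obtain ⟨s, hs⟩ := hsurj (Pi.single (Sum.inl k) 1)
      have h1 := h s
      rw [latticeForm_apply, latticeForm_apply, hs] at h1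
      simpa [Pi.single_apply] using h1
  have hm : intVec m = 0 :=
    Matrix.mulVec_injective_of_isUnit ((Matrix.isUnit_iff_isUnit_det C).2 hC)
      (by rw [hz, Matrix.mulVec_zero])
  funext j
  have := congrFun hm j
  simpa [intVec] using this

variable (d) in
/-- The Gaussian window as an element of `L²`. -/
noncomputable def gaussianLp : Lp ℂ 2 (volume : Measure (Fin d → ℝ)) :=
  memLp_gaussianWindow.toLp _

theorem coeFn_gaussianLp : gaussianLp d =ᵐ[volume] gaussianWindow :=
  MemLp.coeFn_toLp _

theorem gaussianLp_ne_zero : gaussianLp d ≠ 0 := fun h => by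
  have h0 : (gaussianWindow : (Fin d → ℝ) → ℂ) =ᵐ[volume] 0 :=
    coeFn_gaussianLp.symm.trans (h ▸ Lp.coeFn_zero _ _ _)
  obtain ⟨x, hx⟩ := h0.exists
  exact gaussianWindow_ne_zero x hx

theorem lintegral_enorm_sq_inner_latticeRep (hC : IsUnit C.det)
    (f : Lp ℂ 2 (volume : Measure (Fin d → ℝ))) :
    ∫⁻ s, ‖⟪f, latticeRep C s (gaussianLp d)⟫_ℂ‖ₑ ^ 2 =
      ENNReal.ofReal |C.det⁻¹| * ‖f‖ₑ ^ 2 * ‖gaussianLp d‖ₑ ^ 2 :=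
  lintegral_enorm_sq_inner_tfUnitary_mulVec measurable_gaussianWindow coeFn_gaussianLp
    norm_gaussianWindow_le_one hC.ne_zero

theorem measurable_inner_latticeRep (f : Lp ℂ 2 (volume : Measure (Fin d → ℝ))) :
    Measurable fun s => ⟪f, latticeRep C s (gaussianLp d)⟫_ℂ :=
  measurable_inner_tfUnitary_mulVec measurable_gaussianWindow coeFn_gaussianLp C

theorem coeFn_latticeRep (m : Fin d ⊕ Fin d → ℤ)
    (g : Lp ℂ 2 (volume : Measure (Fin d → ℝ))) :
    latticeRep C (intVec m) g =ᵐ[volume]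
      tfShift (fun i => C.mulVec (fun j => (m j : ℝ)) (Sum.inl i))
        (fun i => C.mulVec (fun j => (m j : ℝ)) (Sum.inr i)) g :=
  coeFn_tfUnitary _ _ g

end LatticeRepresentation

/-- There exists `g ∈ L²(ℝ^d)` such that the Gabor system `G(g, Cℤ^{2d})` is an
orthonormal basis of `L²(ℝ^d)` if and only if `|det C| = 1`. -/
theorem stmt5 (d : ℕ) (hd : 1 ≤ d)
    (C : Matrix (Fin d ⊕ Fin d) (Fin d ⊕ Fin d) ℝ) (hC : IsUnit C.det) :
    (∃ (g : Lp ℂ 2 (volume : Measure (Fin d → ℝ)))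
      (G : (Fin d ⊕ Fin d → ℤ) → Lp ℂ 2 (volume : Measure (Fin d → ℝ))),
      (∀ m : Fin d ⊕ Fin d → ℤ, ⇑(G m) =ᵐ[volume]
        tfShift (fun i => C.mulVec (fun j => (m j : ℝ)) (Sum.inl i))
          (fun i => C.mulVec (fun j => (m j : ℝ)) (Sum.inr i)) g) ∧
      Orthonormal ℂ G ∧
      (Submodule.span ℂ (Set.range G)).topologicalClosure = ⊤) ↔
    |C.det| = 1 := by
  have : Nonempty (Fin d ⊕ Fin d) := ⟨Sum.inl ⟨0, hd⟩⟩
  constructor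
  · rintro ⟨g, G, hG, hon, hspan⟩
    have hc := eq_one_of_hilbertBasis_projRep (latticeRep_latticeRep C) gaussianLp_ne_zero
      measurable_inner_latticeRep (lintegral_enorm_sq_inner_latticeRep hC)
      (h := g) (HilbertBasis.mk hon hspan.ge) fun m => by
        rw [HilbertBasis.coe_mk]
        exact Lp.ext ((hG m).trans (coeFn_latticeRep m g).symm)
    rwa [ENNReal.ofReal_eq_one, abs_inv, inv_eq_one] at hc
  · intro hdet
    obtain ⟨h, hon, hspan⟩ := exists_orthonormal_orbit (latticeRep_latticeRep C)
      gaussianLp_ne_zero measurable_inner_latticeRep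
      (fun f => by rw [lintegral_enorm_sq_inner_latticeRep hC, abs_inv, hdet]; simp)
      (summable_norm_inner_tfUnitary_gaussianWindow coeFn_gaussianLp hC)
      (latticeForm_nondegenerate hC)
    exact ⟨h, fun m => latticeRep C (intVec m) h, fun m => coeFn_latticeRep m h, hon, hspan⟩
end
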